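/- Let p be an odd prime, ζ a fixed primitive p-th root of unity in an algebraic closure Q̄ of ℚ, K = ℚ(ζ), and L ⊆ Q̄ the splitting field over K of f_p(x) = 1 − (1 − x^p)^p. If Vandiver's conjecture holds for p, i.e., p does not divide the class number h⁺ of the maximal real subfield K⁺ = ℚ(ζ + ζ⁻¹), then Gal(L/K) is isomorphic to (ℤ/pℤ)^{(p+1)/2}; in particular [L : K] = p^{(p+1)/2}. -/

import Mathlib

section
open Finset

open Classical in
/-- The finset of even Dirichlet characters mod `p`. -/
noncomputable def evenChars (p : ℕ) [NeZero p] : Finset (DirichletCharacter ℂ p) :=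
  Finset.univ.filter (fun χ => χ.Even)

lemma mem_evenChars {p : ℕ} [NeZero p] {χ : DirichletCharacter ℂ p} :
    χ ∈ evenChars p ↔ χ (-1) = 1 := by
  classical
  unfold evenChars
  rw [Finset.mem_filter_univ, DirichletCharacter.Even]

lemma sum_evenChars {p : ℕ} [hp : Fact p.Prime] (hp2 : p ≠ 2) (a : (ZMod p)ˣ) :
    ∑ χ ∈ evenChars p, χ (a : ZMod p) =
      if a = 1 ∨ a = -1 then (((p - 1) / 2 : ℕ) : ℂ) else 0 := by
  have h1 : ∀ χ : DirichletCharacter ℂ p, χ (-1) = 1 ∨ χ (-1) = -1 := fun χ => by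
    have : (χ (-1)) ^ 2 = 1 := by rw [← map_pow]; simp
    have h2 : (χ (-1) - 1) * (χ (-1) + 1) = 0 := by linear_combination this
    rcases mul_eq_zero.mp h2 with h | h
    · exact Or.inl (sub_eq_zero.mp h)
    · exact Or.inr (eq_neg_of_add_eq_zero_left h)
  have key : ∑ χ ∈ evenChars p, χ (a : ZMod p) =
      2⁻¹ * (∑ χ : DirichletCharacter ℂ p, χ (a : ZMod p) + ∑ χ : DirichletCharacter ℂ p, χ (-(a : ZMod p))) := by
    classical
    rw [evenChars, Finset.sum_filter, ← Finset.sum_add_distrib, Finset.mul_sum]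
    refine Finset.sum_congr rfl fun χ _ => ?_
    have : χ (-(a : ZMod p)) = χ (-1) * χ a := by rw [← map_mul]; simp
    rw [this, DirichletCharacter.Even]
    rcases h1 χ with h | h
    · rw [h, if_pos rfl]; ring
    · rw [h, if_neg (by norm_num)]; ring
  have hodd : Odd p := hp.out.odd_of_ne_two hp2
  have hc : (((p - 1) / 2 : ℕ) : ℂ) = 2⁻¹ * (p.totient : ℂ) := by
    rw [Nat.totient_prime hp.out]
    obtain ⟨k, hk⟩ := hodd
    have : p - 1 = 2 * k := by omega
    rw [this]; simp
  have hne : (1 : (ZMod p)ˣ) ≠ -1 := by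
    have : Fact (2 < p) := ⟨by have := hp.out.two_le; omega⟩
    intro h
    have := congrArg Units.val h
    exact ZMod.neg_one_ne_one (n := p) (by simpa using this.symm)
  rw [key, DirichletCharacter.sum_characters_eq, DirichletCharacter.sum_characters_eq, hc]
  have e1 : ((a : ZMod p) = 1) ↔ a = 1 := by simp
  have e2 : (-(a : ZMod p) = 1) ↔ a = -1 := by
    rw [neg_eq_iff_eq_neg, Units.ext_iff]; simp
  simp only [e1, e2]
  by_cases ha : a = 1
  · subst ha; simp [hne]
  · by_cases hb : a = -1
    · subst hb; simp [ha]
    · simp [ha, hb]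

lemma card_evenChars {p : ℕ} [hp : Fact p.Prime] (hp2 : p ≠ 2) :
    (evenChars p).card = (p - 1) / 2 := by
  have := sum_evenChars hp2 (1 : (ZMod p)ˣ)
  simp at this
  exact_mod_cast this

lemma prod_evenChars {p : ℕ} [hp : Fact p.Prime] (hp2 : p ≠ 2) (a : (ZMod p)ˣ) (f g : ℕ)
    (hf0 : 0 < f) (hf : ∀ m, (a ^ m = 1 ∨ a ^ m = -1) ↔ f ∣ m) (hfg : f * g = (p - 1) / 2) (T : ℂ) :
    ∏ χ ∈ evenChars p, (1 - χ (a : ZMod p) * T) = (1 - T ^ f) ^ g := by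
  classical
  have hpos : 0 < (p - 1) / 2 := by
    have := hp.out.two_le; omega
  let E : Subgroup (DirichletCharacter ℂ p) :=
    { carrier := {χ | χ (-1) = 1}
      mul_mem' := fun {x y} hx hy => by
        simp only [Set.mem_ofPred_eq] at *; rw [MulChar.mul_apply, hx, hy, one_mul]
      one_mem' := by
        have : IsUnit (-1 : ZMod p) := isUnit_one.neg
        exact MulChar.one_apply this
      inv_mem' := fun {x} hx => by
        simp only [Set.mem_ofPred_eq] at *
        rw [MulChar.inv_apply_eq_inv', hx, inv_one] }
  have hE : ∀ χ, χ ∈ E ↔ χ ∈ evenChars p := fun χ => by rw [mem_evenChars]; rfl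
  let ev : E →* ℂˣ :=
    { toFun := fun χ => χ.1.toUnitHom a
      map_one' := by ext; simp
      map_mul' := fun x y => by ext; simp [MulChar.mul_apply] }
  have hev : ∀ χ : E, ((ev χ : ℂˣ) : ℂ) = χ.1 (a : ZMod p) := fun χ => by simp [ev]
  set d := Nat.card ev.range with hd
  have hd1 : ∀ χ : E, (ev χ) ^ d = 1 := fun χ => by
    have : (⟨ev χ, χ, rfl⟩ : ev.range) ^ d = 1 := pow_card_eq_one'
    exact congrArg Subtype.val this
  have hfd : f ∣ d := by
    rw [← hf]
    by_contra hcon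
    have h1 := sum_evenChars hp2 (a ^ d)
    rw [if_neg hcon] at h1
    have h2 : ∑ χ ∈ evenChars p, χ ((a ^ d : (ZMod p)ˣ) : ZMod p) = ∑ χ ∈ evenChars p, 1 := by
      refine Finset.sum_congr rfl fun χ hχ => ?_
      have := hd1 ⟨χ, (hE χ).2 hχ⟩
      have := congrArg Units.val this
      rw [Units.val_pow_eq_pow_val, hev] at this
      rw [Units.val_pow_eq_pow_val, map_pow]; simpa using this
    rw [h2] at h1
    simp [card_evenChars hp2] at h1
    omega
  have hpf : ∀ χ : E, (ev χ) ^ f = 1 := fun χ => by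
    rw [← map_pow]
    ext
    rw [hev]
    have : (χ ^ f).1 (a : ZMod p) = χ.1 ((a ^ f : (ZMod p)ˣ) : ZMod p) := by
      rw [Units.val_pow_eq_pow_val, map_pow, Subgroup.coe_pow, MulChar.pow_apply_coe]
    rw [this]
    rcases (hf f).2 dvd_rfl with h | h
    · rw [h]; simp
    · rw [h]; exact χ.2
  let S : Finset ℂ := Finset.univ.image (fun χ : E => ((ev χ : ℂˣ) : ℂ))
  have hScard : S.card = d := by
    rw [hd, ← SetLike.coe_sort_coe, Nat.card_coe_set_eq, MonoidHom.coe_range]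
    have : (S : Set ℂ) = (fun u : ℂˣ => (u : ℂ)) '' (Set.range ev) := by
      ext x; simp [S]
    rw [← Set.ncard_coe_finset, this, Set.ncard_image_of_injective _ Units.val_injective]
  have hprim := Complex.isPrimitiveRoot_exp f hf0.ne'
  have hSsub : S ⊆ Polynomial.nthRootsFinset f (1:ℂ) := by
    intro x hx
    simp only [S, Finset.mem_image, Finset.mem_univ, true_and] at hx
    obtain ⟨χ, rfl⟩ := hx
    rw [Polynomial.mem_nthRootsFinset hf0]
    have := congrArg Units.val (hpf χ)
    simpa using this
  have hdpos : 0 < d := Nat.card_pos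
  have hS : S = Polynomial.nthRootsFinset f (1:ℂ) := by
    refine Finset.eq_of_subset_of_card_le hSsub ?_
    rw [hprim.card_nthRootsFinset, hScard]
    exact Nat.le_of_dvd hdpos hfd
  have hdf : d = f := by rw [← hScard, hS, hprim.card_nthRootsFinset]
  -- product over E
  have hprodE : ∏ χ ∈ evenChars p, (1 - χ (a : ZMod p) * T) =
      ∏ χ : E, (1 - ((ev χ : ℂˣ) : ℂ) * T) := by
    simp only [hev]
    rw [Finset.prod_subtype (evenChars p) (p := fun χ => χ ∈ E) (fun χ => (hE χ).symm)]
  have hcardE : Fintype.card E = (p - 1) / 2 := by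
    rw [← card_evenChars hp2]
    exact Fintype.card_of_subtype _ (fun χ => (hE χ).symm)
  let c := (Finset.univ.filter (fun χ : E => ev χ = 1)).card
  have hfib : ∀ x ∈ S, (Finset.univ.filter (fun χ : E => ((ev χ : ℂˣ) : ℂ) = x)).card = c := by
    intro x hx
    simp only [S, Finset.mem_image, Finset.mem_univ, true_and] at hx
    obtain ⟨χ, rfl⟩ := hx
    have := MonoidHom.card_fiber_eq_of_mem_range ev (x := ev χ) (y := 1) ⟨χ, rfl⟩ ⟨1, map_one _⟩
    simpa [c, Units.val_inj] using this
  have hcg : c = g := by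
    have h1 : Fintype.card E = ∑ x ∈ S, (Finset.univ.filter (fun χ : E => ((ev χ : ℂˣ) : ℂ) = x)).card := by
      rw [← Finset.card_univ]
      exact Finset.card_eq_sum_card_fiberwise (fun χ _ => by simp [S])
    rw [Finset.sum_congr rfl hfib, Finset.sum_const, hScard, hdf, hcardE, ← hfg, smul_eq_mul] at h1
    exact (Nat.eq_of_mul_eq_mul_left hf0 h1).symm
  rw [hprodE, ← Finset.prod_fiberwise_of_maps_to (t := S) (g := fun χ : E => ((ev χ : ℂˣ) : ℂ))
    (fun χ _ => by simp [S])]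
  have : ∀ x ∈ S, ∏ χ ∈ Finset.univ.filter (fun χ : E => ((ev χ : ℂˣ) : ℂ) = x),
      (1 - ((ev χ : ℂˣ) : ℂ) * T) = (1 - x * T) ^ g := by
    intro x hx
    rw [← hcg, ← hfib x hx, ← Finset.prod_const]
    refine Finset.prod_congr rfl fun χ hχ => ?_
    rw [(Finset.mem_filter.1 hχ).2]
  rw [Finset.prod_congr rfl this, Finset.prod_pow, hS, ← hprim.pow_sub_pow_eq_prod_sub_mul 1 T hf0,
    one_pow]
end

section
open NumberField Filter Topology Ideal

section euler
variable (F : Type*) [Field F] [NumberField F]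

/-- the weight `N(I)^(-s)`. -/
noncomputable def idW (s : ℝ) (I : Ideal (𝓞 F)) : ℝ := (absNorm I : ℝ) ^ (-s)

variable {F}

lemma idW_nonneg (s : ℝ) (I : Ideal (𝓞 F)) : 0 ≤ idW F s I := by
  unfold idW; positivity

lemma idW_mul (s : ℝ) (I J : Ideal (𝓞 F)) : idW F s (I * J) = idW F s I * idW F s J := by
  unfold idW
  rw [map_mul, Nat.cast_mul, Real.mul_rpow (by positivity) (by positivity)]

lemma idW_pow (s : ℝ) (I : Ideal (𝓞 F)) (k : ℕ) : idW F s (I ^ k) = idW F s I ^ k := by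
  induction k with
  | zero => simp [idW]
  | succ k ih => rw [pow_succ, idW_mul, ih, pow_succ]

lemma idW_lt_one {s : ℝ} (hs : 1 < s) {P : Ideal (𝓞 F)} (hP : Prime P) : idW F s P < 1 := by
  unfold idW
  apply Real.rpow_lt_one_of_one_lt_of_neg _ (by linarith)
  have h1 : absNorm P ≠ 1 := fun h => hP.not_isUnit (by rw [Ideal.isUnit_iff]; exact absNorm_eq_one_iff.mp h)
  have h0 : absNorm P ≠ 0 := fun h => hP.ne_zero (absNorm_eq_zero_iff.mp h)
  exact_mod_cast (show 1 < absNorm P by omega)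

lemma hasSum_smooth {s : ℝ} (hs : 1 < s) (T : Finset (Ideal (𝓞 F))) (hT : ∀ P ∈ T, Prime P) :
    HasSum (fun I : {I : Ideal (𝓞 F) // I ≠ ⊥ ∧ ∀ P, Prime P → P ∣ I → P ∈ T} => idW F s I.1)
      (∏ P ∈ T, (1 - idW F s P)⁻¹) := by
  classical
  induction T using Finset.induction_on with
  | empty =>
    rw [Finset.prod_empty]
    have : ∀ I : {I : Ideal (𝓞 F) // I ≠ ⊥ ∧ ∀ P, Prime P → P ∣ I → P ∈ (∅ : Finset (Ideal (𝓞 F)))},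
        I = ⟨1, one_ne_zero, fun P hP hd => (hP.not_isUnit (isUnit_of_dvd_one hd)).elim⟩ := by
      rintro ⟨I, hI, h⟩
      apply Subtype.ext
      by_contra hne
      have hnu : ¬ IsUnit I := fun hu => hne (by simpa [Ideal.isUnit_iff] using hu)
      obtain ⟨P, hP, hd⟩ := WfDvdMonoid.exists_irreducible_factor hnu hI
      exact absurd (h P hP.prime hd) (Finset.notMem_empty _)
    convert hasSum_single (f := fun I : {I : Ideal (𝓞 F) // I ≠ ⊥ ∧ ∀ P, Prime P → P ∣ I → P ∈ (∅ : Finset (Ideal (𝓞 F)))} => idW F s I.1)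
      ⟨1, one_ne_zero, fun P hP hd => (hP.not_isUnit (isUnit_of_dvd_one hd)).elim⟩
      (fun I hI => (hI (this I)).elim) using 1
    simp [idW]
  | insert Q T hQ ih =>
    have hQp : Prime Q := hT Q (Finset.mem_insert_self _ _)
    have ih' := ih (fun P hP => hT P (Finset.mem_insert_of_mem hP))
    rw [Finset.prod_insert hQ]
    have hg := hasSum_geometric_of_lt_one (idW_nonneg s Q) (idW_lt_one hs hQp)
    have hprod := hg.mul ih' (hg.summable.mul_of_nonneg ih'.summable
      (fun k => pow_nonneg (idW_nonneg s Q) k) (fun I => idW_nonneg s I.1))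
    let φ : ℕ × {I : Ideal (𝓞 F) // I ≠ ⊥ ∧ ∀ P, Prime P → P ∣ I → P ∈ T} →
        {I : Ideal (𝓞 F) // I ≠ ⊥ ∧ ∀ P, Prime P → P ∣ I → P ∈ insert Q T} := fun x =>
      ⟨Q ^ x.1 * x.2.1, mul_ne_zero (pow_ne_zero _ hQp.ne_zero) x.2.2.1, fun P hP hd => by
        rcases hP.dvd_or_dvd hd with h | h
        · have := hP.dvd_of_dvd_pow h
          have : P = Q := by
            have := (Prime.associated_of_dvd hP hQp this)
            exact associated_iff_eq.mp this
          simp [this]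
        · exact Finset.mem_insert_of_mem (x.2.2.2 P hP h)⟩
    have hnd : ∀ x : {I : Ideal (𝓞 F) // I ≠ ⊥ ∧ ∀ P, Prime P → P ∣ I → P ∈ T}, ¬ Q ∣ x.1 :=
      fun x hd => hQ (x.2.2 Q hQp hd)
    have hφ : Function.Bijective φ := by
      constructor
      · rintro ⟨k, I⟩ ⟨l, J⟩ h
        have h' : Q ^ k * I.1 = Q ^ l * J.1 := congrArg Subtype.val h
        have key : ∀ (k l : ℕ) (I J : Ideal (𝓞 F)), k < l → Q ^ k * I = Q ^ l * J → Q ∣ I := by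
          intro k l I J hkl h
          obtain ⟨m, rfl⟩ := Nat.exists_eq_add_of_lt hkl
          rw [show k + m + 1 = k + (m + 1) by ring, pow_add, mul_assoc] at h
          have := mul_left_cancel₀ (pow_ne_zero _ hQp.ne_zero) h
          rw [this, pow_succ', mul_assoc]
          exact dvd_mul_right _ _
        rcases lt_trichotomy k l with hkl | hkl | hkl
        · exact (hnd I (key _ _ _ _ hkl h')).elim
        · subst hkl
          have := mul_left_cancel₀ (pow_ne_zero _ hQp.ne_zero) h'
          rw [Subtype.ext this]
        · exact (hnd J (key _ _ _ _ hkl h'.symm)).elim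
      · rintro ⟨I, hI, h⟩
        obtain ⟨J, hJ, hJd⟩ := (FiniteMultiplicity.of_prime_left hQp hI).exists_eq_pow_mul_and_not_dvd
        refine ⟨⟨multiplicity Q I, ⟨J, ?_, ?_⟩⟩, Subtype.ext hJ.symm⟩
        · rintro rfl; exact hJd (dvd_zero _)
        · intro P hP hd
          have h1 := h P hP (hJ ▸ dvd_mul_of_dvd_right hd _)
          rcases Finset.mem_insert.mp h1 with h2 | h2
          · subst h2; exact (hJd hd).elim
          · exact h2
    rw [← (Equiv.ofBijective φ hφ).hasSum_iff]
    refine hprod.congr_fun ?_ |> fun h => h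
    intro x
    simp [φ, idW_mul, idW_pow]

lemma zeta_summable {s : ℝ} (hs : 1 < s) :
    Summable (idW F s) ∧ dedekindZeta F (s : ℂ) = ((∑' I, idW F s I : ℝ) : ℂ) := by
  set a : ℕ → ℝ := fun n => (Nat.card {I : Ideal (𝓞 F) // absNorm I = n} : ℝ) with ha
  have hfin : ∀ n, Finite {I : Ideal (𝓞 F) // absNorm I = n} := fun n =>
    (Ideal.finite_setOfPred_absNorm_eq n).to_subtype
  have hsum : LSeriesSummable (fun n => ((a n : ℝ) : ℂ)) (s : ℂ) := by
    refine LSeriesSummable_of_sum_norm_bigO_and_nonneg (r := 1) ?_ (fun _ => Nat.cast_nonneg _)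
      zero_le_one (by simpa using hs)
    have ht : Tendsto (fun n : ℕ => (∑ k ∈ Finset.Icc 1 n, a k) / (n : ℝ)) atTop
        (𝓝 (dedekindZeta_residue F)) := by
      refine ((Ideal.tendsto_norm_le_div_atTop₀ F).comp tendsto_natCast_atTop_atTop).congr fun n ↦ ?_
      simp only [Function.comp_apply, Nat.cast_le, ha, ← Nat.cast_sum]
      congr
      rw [← add_left_inj 1, ← card_norm_le_eq_card_norm_le_add_one,
        show Finset.Icc 1 n = Finset.Ioc 0 n from Finset.Icc_succ_left_eq_Ioc _ _,
        show 1 = Nat.card {I : Ideal (𝓞 F) // absNorm I = 0} by simp [Ideal.absNorm_eq_zero_iff],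
        Finset.sum_Ioc_add_eq_sum_Icc (n.zero_le),
        ← Finset.card_preimage_eq_sum_card_image_eq (fun k _ ↦ finite_setOfPred_absNorm_eq k)]
      simp [Set.coe_eq_subtype]
    have := ht.isBigO_one ℝ
    have h2 := this.mul (Asymptotics.isBigO_refl (fun n : ℕ => (n : ℝ)) atTop)
    refine (h2.congr' ?_ ?_)
    · filter_upwards [eventually_gt_atTop 0] with n hn
      have : (n : ℝ) ≠ 0 := by positivity
      field_simp
    · filter_upwards with n; simp
  have hterm : ∀ n : ℕ, LSeries.term (fun n => ((a n : ℝ) : ℂ)) (s : ℂ) n =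
      ((a n * (n : ℝ) ^ (-s) : ℝ) : ℂ) := by
    intro n
    rcases eq_or_ne n 0 with rfl | hn
    · have : (0 : ℝ) ^ (-s) = 0 := Real.zero_rpow (by linarith)
      simp [this]
    · rw [LSeries.term_of_ne_zero hn, Complex.ofReal_mul, Real.rpow_neg (by positivity),
        Complex.ofReal_inv, Complex.ofReal_cpow (by positivity)]
      rfl
  have hS : Summable (fun n : ℕ => a n * (n : ℝ) ^ (-s)) := by
    have h1 : Summable (LSeries.term (fun n => ((a n : ℝ) : ℂ)) (s : ℂ)) := hsum
    rw [show LSeries.term (fun n => ((a n : ℝ) : ℂ)) (s : ℂ) =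
      fun n : ℕ => ((a n * (n : ℝ) ^ (-s) : ℝ) : ℂ) from funext hterm] at h1
    exact_mod_cast h1
  let e := Equiv.sigmaFiberEquiv (fun I : Ideal (𝓞 F) => absNorm I)
  have hfib : ∀ n : ℕ, ∑' (I : {I : Ideal (𝓞 F) // absNorm I = n}), idW F s (e ⟨n, I⟩) =
      a n * (n : ℝ) ^ (-s) := by
    intro n
    have : ∀ I : {I : Ideal (𝓞 F) // absNorm I = n}, idW F s (e ⟨n, I⟩) = (n : ℝ) ^ (-s) := by
      rintro ⟨I, hI⟩
      simp [e, idW, hI]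
    simp only [this, ha]
    rw [tsum_const, nsmul_eq_mul]
  have hsig : Summable (fun x => idW F s (e x)) := by
    rw [summable_sigma_of_nonneg (fun x => idW_nonneg _ _)]
    refine ⟨fun n => Summable.of_finite, ?_⟩
    simp only [hfib]; exact hS
  refine ⟨(e.summable_iff).mp hsig, ?_⟩
  rw [← e.tsum_eq, Summable.tsum_sigma hsig]
  simp only [hfib]
  rw [Complex.ofReal_tsum]
  simp only [← hterm]
  rfl

lemma zeta_euler {s : ℝ} (hs : 1 < s) :
    Tendsto (fun N : ℕ => ∏ q ∈ N.primesBelow,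
      ∏ P ∈ IsDedekindDomain.primesOverFinset (span {(q : ℤ)}) (𝓞 F), (1 - idW F s P)⁻¹) atTop
      (𝓝 (∑' I, idW F s I)) := by
  classical
  have hspan : ∀ {q : ℕ}, q.Prime → (span {(q : ℤ)} ≠ ⊥ ∧ (span {(q : ℤ)}).IsMaximal) := by
    intro q hq
    have hq' : Prime (q : ℤ) := Nat.prime_iff_prime_int.mp hq
    refine ⟨by simpa using hq.ne_zero, ?_⟩
    exact PrincipalIdealRing.isMaximal_of_irreducible hq'.irreducible
  have hmem : ∀ {q : ℕ}, q.Prime → ∀ {P : Ideal (𝓞 F)},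
      P ∈ IsDedekindDomain.primesOverFinset (span {(q : ℤ)}) (𝓞 F) ↔
        P ∈ (span {(q : ℤ)}).primesOver (𝓞 F) := by
    intro q hq P
    have := (hspan hq).2
    exact IsDedekindDomain.mem_primesOverFinset_iff (hspan hq).1 (𝓞 F)
  let T : ℕ → Finset (Ideal (𝓞 F)) := fun N => N.primesBelow.biUnion
    (fun q => IsDedekindDomain.primesOverFinset (span {(q : ℤ)}) (𝓞 F))
  have hT : ∀ N, ∀ P ∈ T N, Prime P := by
    intro N P hP
    simp only [T, Finset.mem_biUnion] at hP
    obtain ⟨q, hq, hP⟩ := hP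
    have hqp := Nat.prime_of_mem_primesBelow hq
    rw [hmem hqp] at hP
    obtain ⟨h1, h2⟩ := hP
    refine Ideal.prime_of_isPrime ?_ h1
    rintro rfl
    have := h2.over
    rw [Ideal.under_bot] at this
    exact (hspan hqp).1 this
  have hprod : ∀ N : ℕ, ∏ q ∈ N.primesBelow,
      ∏ P ∈ IsDedekindDomain.primesOverFinset (span {(q : ℤ)}) (𝓞 F), (1 - idW F s P)⁻¹ =
      ∏ P ∈ T N, (1 - idW F s P)⁻¹ := by
    intro N
    rw [Finset.prod_biUnion]
    intro q hq r hr hqr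
    have hqp := Nat.prime_of_mem_primesBelow hq
    have hrp := Nat.prime_of_mem_primesBelow hr
    rw [Function.onFun, Finset.disjoint_left]
    intro P hP hP'
    rw [hmem hqp] at hP
    rw [hmem hrp] at hP'
    have h1 := hP.2.over
    have h2 := hP'.2.over
    rw [← h2] at h1
    apply hqr
    have := Ideal.span_singleton_eq_span_singleton.mp h1
    have := Int.natAbs_eq_iff_associated.mpr this
    simpa using this
  simp only [hprod]
  have hsm : ∀ N : ℕ, ∏ P ∈ T N, (1 - idW F s P)⁻¹ =
      ∑' I, Set.indicator {I : Ideal (𝓞 F) | I ≠ ⊥ ∧ ∀ P, Prime P → P ∣ I → P ∈ T N} (idW F s) I := by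
    intro N
    rw [← tsum_subtype]
    exact (hasSum_smooth hs (T N) (hT N)).tsum_eq.symm
  simp only [hsm]
  refine tendsto_tsum_of_dominated_convergence (bound := idW F s) (zeta_summable hs).1 ?_ ?_
  · intro I
    rcases eq_or_ne I ⊥ with rfl | hI
    · have : idW F s ⊥ = 0 := by
        simp only [idW, absNorm_bot, Nat.cast_zero]; exact Real.zero_rpow (by linarith)
      rw [this]
      refine tendsto_const_nhds.congr fun N => ?_
      simp
    · refine tendsto_const_nhds.congr' ?_
      filter_upwards [eventually_gt_atTop (absNorm I)] with N hN
      rw [Set.indicator_of_mem]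
      refine ⟨hI, fun P hP hd => ?_⟩
      have hPp : P.IsPrime := Ideal.isPrime_of_prime hP
      have : NeZero P := ⟨hP.ne_zero⟩
      have hq := Nat.absNorm_under_prime P
      simp only [T, Finset.mem_biUnion]
      refine ⟨absNorm (under ℤ P), ?_, ?_⟩
      · rw [Nat.mem_primesBelow]
        refine ⟨lt_of_le_of_lt (Nat.le_of_dvd ?_ ?_) hN, hq⟩
        · exact Nat.pos_of_ne_zero fun h => hI (absNorm_eq_zero_iff.mp h)
        · exact (Int.absNorm_under_dvd_absNorm P).trans (absNorm_dvd_absNorm_of_le (Ideal.le_of_dvd hd))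
      · rw [hmem hq]
        exact ⟨hPp, Int.liesOver_span_absNorm P⟩
  · refine Eventually.of_forall fun N I => ?_
    rw [Real.norm_of_nonneg (Set.indicator_nonneg (fun _ _ => idW_nonneg _ _) _)]
    exact Set.indicator_le_self' (fun _ _ => idW_nonneg _ _) _
end euler
end

section
open NumberField Ideal

lemma ff_frob (q : ℕ) [hq : Fact q.Prime] (k : Type*) [Field k] [Finite k] (d : ℕ)
    (hc : Nat.card k = q ^ d) (m : ℕ) : (∀ x : k, x ^ (q ^ m) = x) ↔ d ∣ m := by
  have := Fintype.ofFinite k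
  have hd : d ≠ 0 := by
    rintro rfl
    have : 1 < Nat.card k := Finite.one_lt_card
    rw [hc] at this
    simp at this
  have hch : CharP k q := by
    obtain ⟨r, hr⟩ := CharP.exists k
    obtain ⟨n, hrp, hn⟩ := FiniteField.card k r
    rw [← Nat.card_eq_fintype_card, hc] at hn
    have : r ∣ q := by
      have : r ∣ q ^ d := by rw [hn]; exact dvd_pow_self r n.ne_zero
      exact hrp.dvd_of_dvd_pow this
    rwa [← (Nat.prime_dvd_prime_iff_eq hrp hq.out).1 this]
  let _ := ZMod.algebra k q
  have h := FiniteField.orderOf_frobeniusAlgEquivOfAlgebraic (ZMod q) k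
  have hfr : Module.finrank (ZMod q) k = d := by
    have := Module.natCard_eq_pow_finrank (K := ZMod q) (V := k)
    rw [hc, Nat.card_zmod] at this
    exact (Nat.pow_right_injective hq.out.two_le this).symm
  rw [← hfr, ← h, orderOf_dvd_iff_pow_eq_one]
  have key : ∀ x : k, (FiniteField.frobeniusAlgEquivOfAlgebraic (ZMod q) k ^ m) x = x ^ (q ^ m) := by
    intro x
    induction m with
    | zero => simp
    | succ m ih =>
      rw [pow_succ', AlgEquiv.mul_apply, ih]
      simp [pow_succ, pow_mul]
  constructor
  · intro hx
    ext x
    rw [key, hx]; rfl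
  · intro hx x
    rw [← key, hx]; rfl

section
variable {p : ℕ} [hp : Fact p.Prime] (K : Type*) [Field K] [NumberField K]
  [IsCyclotomicExtension {p} ℚ K] [IsCMField K]
local notation "K⁺" => maximalRealSubfield K

lemma conj_prim {ζ : 𝓞 K} (hζ : IsPrimitiveRoot ζ p) :
    IsCMField.ringOfIntegersComplexConj K ζ * ζ = 1 := by
  have hu : IsUnit ζ := hζ.isUnit hp.out.ne_zero
  have ht : hu.unit ∈ NumberField.Units.torsion K := by
    rw [NumberField.Units.torsion, CommGroup.mem_torsion, isOfFinOrder_iff_pow_eq_one]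
    exact ⟨p, hp.out.pos, by ext; simp [hζ.pow_eq_one]⟩
  have h := IsCMField.complexConj_torsion K ⟨hu.unit, ht⟩
  simp only [IsUnit.unit_spec] at h
  have h' : algebraMap (𝓞 K) K (IsCMField.ringOfIntegersComplexConj K ζ) =
    (algebraMap (𝓞 K) K ζ)⁻¹ := h
  apply RingOfIntegers.ext
  change algebraMap (𝓞 K) K _ = algebraMap (𝓞 K) K _
  rw [map_mul, h', map_one, inv_mul_cancel₀]
  simpa using hζ.ne_zero hp.out.ne_zero

lemma split_aux (q : ℕ) [hq : Fact q.Prime] (hqp : q ≠ p) (a : (ZMod p)ˣ)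
    (ha : (a : ZMod p) = q) (v : Ideal (𝓞 K⁺)) [v.IsPrime] [v.LiesOver (span {(q : ℤ)})] (m : ℕ) :
    (a ^ m = 1 ∨ a ^ m = -1) ↔ v.inertiaDeg ℤ ∣ m := by
  have hv0 : v ≠ ⊥ := by
    have : (span {(q : ℤ)}) ≠ ⊥ := by simp [hq.out.ne_zero]
    exact Ideal.ne_bot_of_liesOver_of_ne_bot this v
  have hvm : v.IsMaximal := Ideal.IsPrime.isMaximal inferInstance hv0
  let _ := Ideal.Quotient.field v
  have : Finite (𝓞 K⁺ ⧸ v) := Ring.HasFiniteQuotients.finiteQuotient hv0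
  have hcard : Nat.card (𝓞 K⁺ ⧸ v) = q ^ v.inertiaDeg ℤ := (Ideal.pow_inertiaDeg q v).symm
  rw [← ff_frob q _ _ hcard]
  obtain ⟨V, hVp, hVo⟩ := (inferInstance : Nonempty (v.primesOver (𝓞 K)))
  have hVq : V.LiesOver (span {(q : ℤ)}) := Ideal.LiesOver.trans V v _
  have hV0 : V ≠ ⊥ := Ideal.ne_bot_of_liesOver_of_ne_bot hv0 V
  have hVm : V.IsMaximal := Ideal.IsPrime.isMaximal inferInstance hV0
  let _ := Ideal.Quotient.field V
  have hζ := (IsCyclotomicExtension.zeta_spec p ℚ K)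
  have hz : IsPrimitiveRoot (Ideal.Quotient.mk V hζ.toInteger) p := by
    refine hζ.toInteger_isPrimitiveRoot.idealQuotient_mk
      (by simpa using IsMaximal.ne_top inferInstance) ?_
    rw [← pow_inertiaDeg q]
    exact Nat.Coprime.pow_left _ ((Nat.coprime_primes hq.out hp.out).2 hqp)
  set c := IsCMField.ringOfIntegersComplexConj K
  set zi := hζ.toInteger
  have hcz : c zi * zi = 1 := conj_prim K hζ.toInteger_isPrimitiveRoot
  have hchV : CharP (𝓞 K ⧸ V) q := by
    have : (q : 𝓞 K ⧸ V) = 0 := by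
      have h1 : ((q : ℤ) : 𝓞 K) ∈ V := by
        have : (q : ℤ) ∈ V.under ℤ := by
          rw [← Ideal.over_def V (span {(q : ℤ)})]
          exact Ideal.mem_span_singleton_self _
        simpa [Ideal.mem_comap] using this
      have := Ideal.Quotient.eq_zero_iff_mem.2 h1
      simpa using this
    exact (CharP.charP_iff_prime_eq_zero hq.out).2 this
  have hmem : ∀ y : 𝓞 K⁺, y ∈ v ↔ algebraMap (𝓞 K⁺) (𝓞 K) y ∈ V := fun y =>
    Ideal.mem_of_liesOver V v y
  have hzc : Ideal.Quotient.mk V (c zi) * Ideal.Quotient.mk V zi = 1 := by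
    rw [← map_mul, hcz, map_one]
  have ham : ∀ b : ℕ, ((a ^ m : (ZMod p)ˣ) : ZMod p) = b ↔
      (Ideal.Quotient.mk V zi) ^ (q ^ m) = (Ideal.Quotient.mk V zi) ^ b := by
    intro b
    rw [(hz.isOfFinOrder hp.out.ne_zero).pow_inj_mod, ← hz.eq_orderOf, ← ZMod.natCast_eq_natCast_iff']
    push_cast
    rw [ha]
  have ha1 : a ^ m = 1 ↔ (Ideal.Quotient.mk V zi) ^ (q ^ m) = (Ideal.Quotient.mk V zi) := by
    rw [Units.ext_iff]
    simpa using ham 1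
  have ha2 : a ^ m = -1 ↔ (Ideal.Quotient.mk V zi) ^ (q ^ m) = (Ideal.Quotient.mk V (c zi)) := by
    rw [Units.ext_iff]
    have h1 : ((p - 1 : ℕ) : ZMod p) = -1 := by
      rw [Nat.cast_sub hp.out.one_le]; simp
    have h2 := ham (p - 1)
    rw [h1] at h2
    have h3 : (Ideal.Quotient.mk V zi) ^ (p - 1) = Ideal.Quotient.mk V (c zi) := by
      have h4 : (Ideal.Quotient.mk V zi) ^ (p - 1) * Ideal.Quotient.mk V zi = 1 := by
        rw [pow_sub_one_mul hp.out.ne_zero, hz.pow_eq_one]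
      have h5 : Ideal.Quotient.mk V zi ≠ 0 := hz.ne_zero hp.out.ne_zero
      exact mul_right_cancel₀ h5 (h4.trans hzc.symm)
    rw [h3] at h2
    simpa using h2
  constructor
  · intro h
    obtain ⟨σ, hσ, hσz⟩ : ∃ σ : 𝓞 K →+* 𝓞 K, (∀ y : 𝓞 K⁺, σ (algebraMap _ _ y) = algebraMap _ _ y) ∧
        (Ideal.Quotient.mk V zi) ^ (q ^ m) = Ideal.Quotient.mk V (σ zi) := by
      rcases h with h | h
      · exact ⟨RingHom.id _, fun y => rfl, ha1.1 h⟩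
      · exact ⟨(c : 𝓞 K →+* 𝓞 K), fun y => by simp, ha2.1 h⟩
    have heq : (iterateFrobenius (𝓞 K ⧸ V) q m).comp (Ideal.Quotient.mk V) =
        (Ideal.Quotient.mk V).comp σ := by
      have : ((iterateFrobenius (𝓞 K ⧸ V) q m).comp (Ideal.Quotient.mk V)).toIntAlgHom =
        ((Ideal.Quotient.mk V).comp σ).toIntAlgHom := by
        apply hζ.integralPowerBasis.algHom_ext
        simpa [iterateFrobenius_def, IsPrimitiveRoot.integralPowerBasis_gen] using hσz
      ext x
      exact DFunLike.congr_fun this x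
    intro x
    obtain ⟨y, rfl⟩ := Ideal.Quotient.mk_surjective x
    rw [← map_pow, Ideal.Quotient.eq, hmem, map_sub, map_pow, ← Ideal.Quotient.eq, map_pow]
    have := DFunLike.congr_fun heq (algebraMap _ _ y)
    simp only [RingHom.comp_apply, iterateFrobenius_def, hσ] at this
    exact this
  · intro h
    have hfix : c (zi + c zi) = zi + c zi := by
      rw [map_add, add_comm]
      congr 1
      apply RingOfIntegers.ext
      simp [c]
    obtain ⟨y, hy⟩ := (IsCMField.ringOfIntegersComplexConj_eq_self_iff K _).1 hfix
    have h1 := h (Ideal.Quotient.mk v y)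
    rw [← map_pow, Ideal.Quotient.eq, hmem, map_sub, map_pow, ← Ideal.Quotient.eq, map_pow, hy,
      map_add, add_pow_char_pow] at h1
    rw [ha1, ha2]
    set z := Ideal.Quotient.mk V zi
    set z' := Ideal.Quotient.mk V (c zi)
    have hZ : z' ^ (q ^ m) * z ^ (q ^ m) = 1 := by rw [← mul_pow, hzc, one_pow]
    have : (z ^ (q ^ m) - z) * (z ^ (q ^ m) - z') = 0 := by
      linear_combination (z ^ (q ^ m)) * h1 + hzc - hZ
    rcases mul_eq_zero.1 this with h | h
    · exact Or.inl (sub_eq_zero.1 h)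
    · exact Or.inr (sub_eq_zero.1 h)

lemma finrank_real : Module.finrank ℚ K⁺ = (p - 1) / 2 := by
  have h1 := Module.finrank_mul_finrank ℚ K⁺ K
  rw [IsCyclotomicExtension.finrank K (Polynomial.cyclotomic.irreducible_rat hp.out.pos),
    Nat.totient_prime hp.out, Algebra.IsQuadraticExtension.finrank_eq_two K⁺ K] at h1
  omega

lemma sum_ef (F : Type*) [Field F] [NumberField F] (q : ℕ) [hq : Fact q.Prime] :
    ∑ P ∈ IsDedekindDomain.primesOverFinset (span {(q:ℤ)}) (𝓞 F),
      P.ramificationIdx ℤ * P.inertiaDeg ℤ = Module.finrank ℚ F := by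
  have hq0 : (span {(q:ℤ)}) ≠ ⊥ := by simp [hq.out.ne_zero]
  have hqp : (span {(q:ℤ)}).IsPrime := by
    rw [Ideal.span_singleton_prime (by exact_mod_cast hq.out.ne_zero)]
    exact Nat.prime_iff_prime_int.1 hq.out
  have hqm : (span {(q:ℤ)}).IsMaximal := hqp.isMaximal hq0
  have : Fintype ((span {(q:ℤ)}).primesOver (𝓞 F)) :=
    (IsDedekindDomain.primesOver_finite (span {(q:ℤ)}) (𝓞 F)).fintype
  have h := Ideal.sum_ramification_inertia_eq_finrank (span {(q:ℤ)}) (𝓞 F)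
  rw [RingOfIntegers.rank] at h
  rw [← h]
  exact Finset.sum_subtype _ (fun P => IsDedekindDomain.mem_primesOverFinset_iff hq0 _)
    (fun P => P.ramificationIdx ℤ * P.inertiaDeg ℤ)

lemma mem_pof {F : Type*} [Field F] [NumberField F] {q : ℕ} (hq : q.Prime) {P : Ideal (𝓞 F)} :
    P ∈ IsDedekindDomain.primesOverFinset (span {(q:ℤ)}) (𝓞 F) ↔
      P.IsPrime ∧ P.LiesOver (span {(q:ℤ)}) := by
  have hq0 : (span {(q:ℤ)}) ≠ ⊥ := by simp [hq.ne_zero]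
  have hqp : (span {(q:ℤ)}).IsPrime := by
    rw [Ideal.span_singleton_prime (by exact_mod_cast hq.ne_zero)]
    exact Nat.prime_iff_prime_int.1 hq
  have hqm : (span {(q:ℤ)}).IsMaximal := hqp.isMaximal hq0
  exact IsDedekindDomain.mem_primesOverFinset_iff hq0 _

lemma local_ne (hp2 : p ≠ 2) (q : ℕ) [hq : Fact q.Prime] (hqp : q ≠ p) (s : ℝ) :
    ((∏ P ∈ IsDedekindDomain.primesOverFinset (span {(q:ℤ)}) (𝓞 K⁺), (1 - idW K⁺ s P)⁻¹ : ℝ) : ℂ)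
      = ∏ χ ∈ evenChars p, (1 - χ (q : ZMod p) * (q : ℂ) ^ (-(s:ℂ)))⁻¹ := by
  have hcop : q.Coprime p := (Nat.coprime_primes hq.out hp.out).2 hqp
  obtain ⟨a, ha⟩ : ∃ a : (ZMod p)ˣ, (a : ZMod p) = q :=
    ⟨ZMod.unitOfCoprime q hcop, ZMod.coe_unitOfCoprime q hcop⟩
  have hsum := sum_ef K⁺ q
  rw [finrank_real K (p := p)] at hsum
  set S := IsDedekindDomain.primesOverFinset (span {(q:ℤ)}) (𝓞 K⁺) with hS
  have hmem : ∀ P ∈ S, P.IsPrime ∧ P.LiesOver (span {(q:ℤ)}) := fun P hP => (mem_pof hq.out).1 hP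
  have hne : S.Nonempty := by
    rw [Finset.nonempty_iff_ne_empty]
    intro h
    rw [h, Finset.sum_empty] at hsum
    have := hp.out.two_le
    omega
  obtain ⟨P0, hP0⟩ := hne
  have hfd : ∀ P ∈ S, ∀ m, (a ^ m = 1 ∨ a ^ m = -1) ↔ P.inertiaDeg ℤ ∣ m := by
    intro P hP m
    obtain ⟨h1, h2⟩ := hmem P hP
    exact split_aux K q hqp a ha P m
  set f := P0.inertiaDeg ℤ with hf
  have hff : ∀ P ∈ S, P.inertiaDeg ℤ = f := by
    intro P hP
    apply Nat.dvd_antisymm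
    · rw [← hfd P hP, hfd P0 hP0]
    · rw [← hfd P0 hP0, hfd P hP]
  have hram : ∀ P ∈ S, P.ramificationIdx ℤ = 1 := by
    intro P hP
    obtain ⟨h1, h2⟩ := hmem P hP
    obtain ⟨V, hVp, hVo⟩ := (inferInstance : Nonempty (P.primesOver (𝓞 K)))
    have hVq : V.LiesOver (span {(q : ℤ)}) := Ideal.LiesOver.trans V P _
    have h3 : V.ramificationIdx ℤ = 1 :=
      IsCyclotomicExtension.Rat.ramificationIdx_eq_of_not_dvd (m := p) q K V
        (fun h => hqp ((Nat.prime_dvd_prime_iff_eq hq.out hp.out).1 h))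
    have := Ideal.ramificationIdx_tower (R := ℤ) P V
    rw [h3] at this
    exact Nat.eq_one_of_mul_eq_one_right this.symm
  have hfg : f * S.card = (p - 1) / 2 := by
    rw [← hsum, Finset.sum_congr rfl (fun P hP => by rw [hff P hP, hram P hP, one_mul]),
      Finset.sum_const, smul_eq_mul, mul_comm]
  have hf0 : 0 < f := by
    rcases Nat.eq_zero_or_pos f with h | h
    · rw [h] at hfg
      have := hp.out.two_le
      omega
    · exact h
  have hW : ∀ P ∈ S, idW K⁺ s P = ((q : ℝ) ^ (-s)) ^ f := by
    intro P hP
    obtain ⟨h1, h2⟩ := hmem P hP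
    rw [idW, ← Ideal.pow_inertiaDeg q P, hff P hP]
    push_cast
    rw [← Real.rpow_natCast_mul (by positivity), ← Real.rpow_mul_natCast (by positivity), mul_comm]
  rw [Finset.prod_congr rfl (fun P hP => by rw [hW P hP]), Finset.prod_const, Finset.prod_inv_distrib,
    ← ha, prod_evenChars hp2 a f S.card hf0 (hfd P0 hP0) hfg, inv_pow]
  push_cast
  rw [Complex.ofReal_cpow (by positivity)]
  simp

lemma local_eq (s : ℝ) :
    ∏ P ∈ IsDedekindDomain.primesOverFinset (span {(p:ℤ)}) (𝓞 K⁺), (1 - idW K⁺ s P)⁻¹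
      = (1 - (p : ℝ) ^ (-s))⁻¹ := by
  have hζ := (IsCyclotomicExtension.zeta_spec p ℚ K)
  have key : ∀ P ∈ IsDedekindDomain.primesOverFinset (span {(p:ℤ)}) (𝓞 K⁺),
      P = (span {hζ.toInteger - 1}).under (𝓞 K⁺) ∧ absNorm P = p := by
    intro P hP
    obtain ⟨h1, h2⟩ := (mem_pof hp.out).1 hP
    obtain ⟨V, hVp, hVo⟩ := (inferInstance : Nonempty (P.primesOver (𝓞 K)))
    have hVq : V.LiesOver (span {(p : ℤ)}) := Ideal.LiesOver.trans V P _
    have h3 := IsCyclotomicExtension.Rat.eq_span_zeta_sub_one_of_liesOver' p K hζ V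
    have h4 := IsCyclotomicExtension.Rat.inertiaDeg_eq_of_prime p K V
    have := Ideal.inertiaDeg_tower (R := ℤ) P V
    rw [h4] at this
    refine ⟨by rw [← h3]; exact Ideal.over_def V P, ?_⟩
    rw [← Ideal.pow_inertiaDeg p P, Nat.eq_one_of_mul_eq_one_right this.symm, pow_one]
  have hsum := sum_ef K⁺ p
  have : ∃ P, P ∈ IsDedekindDomain.primesOverFinset (span {(p:ℤ)}) (𝓞 K⁺) := by
    by_contra! h
    rw [Finset.sum_eq_zero (fun P hP => (h P hP).elim)] at hsum
    exact Module.finrank_pos.ne hsum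
  obtain ⟨P, hP⟩ := this
  have : IsDedekindDomain.primesOverFinset (span {(p:ℤ)}) (𝓞 K⁺) = {P} := by
    ext Q
    rw [Finset.mem_singleton]
    exact ⟨fun hQ => (key Q hQ).1.trans (key P hP).1.symm, fun h => h ▸ hP⟩
  rw [this, Finset.prod_singleton, idW, (key P hP).2]
end
end

section
open NumberField Ideal Filter Topology

section
variable {p : ℕ} [hp : Fact p.Prime] (K : Type*) [Field K] [NumberField K]
  [IsCyclotomicExtension {p} ℚ K] [IsCMField K]
local notation "K⁺" => maximalRealSubfield K

lemma one_mem_evenChars : (1 : DirichletCharacter ℂ p) ∈ evenChars p := by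
  rw [mem_evenChars, MulChar.one_apply]
  exact isUnit_one.neg

open Classical in
lemma zeta_factor (hp2 : p ≠ 2) {s : ℝ} (hs : 1 < s) :
    dedekindZeta K⁺ (s : ℂ) = riemannZeta s *
      ∏ χ ∈ (evenChars p).erase 1, DirichletCharacter.LFunction χ (s : ℂ) := by
  have hs' : 1 < (s : ℂ).re := by simpa using hs
  obtain ⟨-, h2⟩ := zeta_summable (F := K⁺) hs
  rw [h2]
  have hA : Tendsto (fun N : ℕ => ((∏ q ∈ N.primesBelow, ∏ P ∈ IsDedekindDomain.primesOverFinset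
      (span {(q:ℤ)}) (𝓞 K⁺), (1 - idW K⁺ s P)⁻¹ : ℝ) : ℂ)) atTop
      (𝓝 ((∑' I, idW K⁺ s I : ℝ) : ℂ)) :=
    (Complex.continuous_ofReal.tendsto _).comp (zeta_euler hs)
  have hB : Tendsto (fun N : ℕ => (∏ q ∈ N.primesBelow, (1 - (q:ℂ) ^ (-(s:ℂ)))⁻¹) *
      ∏ χ ∈ (evenChars p).erase 1, ∏ q ∈ N.primesBelow, (1 - χ (q : ZMod p) * (q:ℂ) ^ (-(s:ℂ)))⁻¹) atTop
      (𝓝 (riemannZeta s * ∏ χ ∈ (evenChars p).erase 1, DirichletCharacter.LFunction χ (s : ℂ))) := by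
    apply (riemannZeta_eulerProduct hs').mul
    apply tendsto_finsetProd
    intro χ _
    rw [DirichletCharacter.LFunction_eq_LSeries χ hs']
    exact DirichletCharacter.LSeries_eulerProduct χ hs'
  refine tendsto_nhds_unique hA (hB.congr ?_)
  intro N
  rw [Finset.prod_comm, ← Finset.prod_mul_distrib]
  push_cast
  refine Finset.prod_congr rfl fun q hq => ?_
  have hqp : q.Prime := Nat.prime_of_mem_primesBelow hq
  have : Fact q.Prime := ⟨hqp⟩
  by_cases h : q = p
  · subst h
    have := local_eq (p := q) K s
    apply_fun ((↑) : ℝ → ℂ) at this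
    push_cast at this
    rw [this, Complex.ofReal_cpow (by positivity)]
    have h0 : ∀ x : DirichletCharacter ℂ q, x ((q : ℕ) : ZMod q) = 0 := fun x => by
      rw [ZMod.natCast_self]
      exact x.map_nonunit not_isUnit_zero
    simp only [h0]
    simp
  · have := local_ne (p := p) K hp2 q h s
    push_cast at this
    rw [this, ← Finset.mul_prod_erase _ _ one_mem_evenChars]
    congr 3
    rw [MulChar.one_apply, one_mul]
    exact (ZMod.isUnit_iff_coprime q p).2 ((Nat.coprime_primes hqp hp.out).2 h)

open Classical in
lemma residue_eq (hp2 : p ≠ 2) :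
    ((dedekindZeta_residue K⁺ : ℝ) : ℂ) =
      ∏ χ ∈ (evenChars p).erase 1, DirichletCharacter.LFunction χ 1 := by
  have h1 := tendsto_sub_one_mul_dedekindZeta_nhdsGT K⁺
  have hlim : Tendsto (fun s : ℝ => (s : ℂ)) (𝓝[>] 1) (𝓝[≠] 1) := by
    apply tendsto_nhdsWithin_iff.2
    refine ⟨?_, ?_⟩
    · have := (Complex.continuous_ofReal.tendsto 1).mono_left (nhdsWithin_le_nhds (s := Set.Ioi 1))
      simpa using this
    · filter_upwards [self_mem_nhdsWithin] with s hs
      have : s ≠ 1 := ne_of_gt hs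
      simpa using this
  have h2 : Tendsto (fun s : ℝ => ((s : ℂ) - 1) * riemannZeta s *
      ∏ χ ∈ (evenChars p).erase 1, DirichletCharacter.LFunction χ (s : ℂ)) (𝓝[>] 1)
      (𝓝 (1 * ∏ χ ∈ (evenChars p).erase 1, DirichletCharacter.LFunction χ 1)) := by
    apply Tendsto.mul
    · exact riemannZeta_residue_one.comp hlim
    · apply tendsto_finsetProd
      intro χ hχ
      have hc := (DirichletCharacter.differentiable_LFunction (Finset.ne_of_mem_erase hχ)).continuous
      exact (hc.tendsto 1).comp (hlim.mono_right nhdsWithin_le_nhds)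
  rw [one_mul] at h2
  refine tendsto_nhds_unique h1 (h2.congr' ?_)
  filter_upwards [self_mem_nhdsWithin] with s hs
  rw [zeta_factor K hp2 hs, mul_assoc]
end
end

section
open Filter Topology

section
variable {p : ℕ} [hp : Fact p.Prime]

noncomputable def chB (χ : DirichletCharacter ℂ p) (n : ℕ) : ℂ := ∑ i ∈ Finset.range n, χ ((i + 1 : ℕ) : ZMod p)

noncomputable def fS (s : ℝ) (i : ℕ) : ℝ := ((i : ℝ) + 1) ^ (-s)

lemma chB_bdd (χ : DirichletCharacter ℂ p) (hχ : χ ≠ 1) (n : ℕ) : ‖chB χ n‖ ≤ p := by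
  have hper : ∀ n, chB χ (n + p) = chB χ n := by
    intro n
    induction n with
    | zero =>
      have h := MulChar.sum_eq_zero_of_ne_one hχ
      simp only [chB, zero_add, Finset.range_zero, Finset.sum_empty]
      have h2 : ∑ i ∈ Finset.range p, χ ((i + 1 : ℕ) : ZMod p) =
          ∑ i ∈ Finset.range p, χ ((i : ℕ) : ZMod p) := by
        have h1 := Finset.sum_range_succ (fun i : ℕ => χ (i : ZMod p)) p
        have h2 := Finset.sum_range_succ' (fun i : ℕ => χ (i : ZMod p)) p
        rw [h1] at h2
        simp only [ZMod.natCast_self, Nat.cast_zero] at h2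
        exact (add_right_cancel h2).symm
      rw [h2, ← h, Finset.sum_range]
      obtain ⟨k, rfl⟩ := Nat.exists_eq_succ_of_ne_zero hp.out.ne_zero
      refine Finset.sum_congr rfl fun i _ => ?_
      congr 1
      exact Fin.cast_val_eq_self i
    | succ n ih =>
      rw [show n + 1 + p = (n + p) + 1 by ring]
      simp only [chB] at ih ⊢
      rw [Finset.sum_range_succ, Finset.sum_range_succ, ih]
      congr 2
      simp
  have hmod : chB χ n = chB χ (n % p) := ((show Function.Periodic (chB χ) p from hper).map_mod_nat n).symm
  rw [hmod]
  calc ‖chB χ (n % p)‖ ≤ ∑ i ∈ Finset.range (n % p), ‖χ ((i + 1 : ℕ) : ZMod p)‖ := norm_sum_le _ _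
    _ ≤ ∑ i ∈ Finset.range (n % p), 1 := Finset.sum_le_sum fun i _ => DirichletCharacter.norm_le_one χ _
    _ = (n % p : ℕ) := by simp
    _ ≤ p := by exact_mod_cast (Nat.mod_lt n hp.out.pos).le

lemma parts (χ : DirichletCharacter ℂ p) (s : ℝ) (N : ℕ) :
    ∑ i ∈ Finset.range N, (fS s i : ℂ) * χ ((i + 1 : ℕ) : ZMod p) =
      fS s N * chB χ N + ∑ i ∈ Finset.range N, ((fS s i - fS s (i + 1) : ℝ) : ℂ) * chB χ (i + 1) := by
  induction N with
  | zero => simp [chB]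
  | succ N ih =>
    rw [Finset.sum_range_succ, ih, Finset.sum_range_succ]
    have : chB χ (N + 1) = chB χ N + χ ((N + 1 : ℕ) : ZMod p) := by
      rw [chB, Finset.sum_range_succ]; rfl
    rw [this]
    push_cast
    ring

lemma fS_diff {s : ℝ} (h1 : 1 ≤ s) (h2 : s ≤ 2) (i : ℕ) :
    |fS s i - fS s (i + 1)| ≤ 2 / ((i : ℝ) + 1) ^ 2 := by
  have hi : (0 : ℝ) < (i : ℝ) + 1 := by positivity
  have hi2 : (0 : ℝ) < (i : ℝ) + 2 := by positivity
  have hb := one_add_mul_self_le_rpow_one_add (s := -1 / ((i : ℝ) + 2)) (p := s)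
    (by rw [le_div_iff₀ hi2]; linarith) h1
  have e1 : 1 + -1 / ((i : ℝ) + 2) = ((i : ℝ) + 1) / (i + 2) := by field_simp; ring
  rw [e1, Real.div_rpow hi.le hi2.le] at hb
  have hf : fS s (i + 1) = fS s i * (((i : ℝ) + 1) ^ s / ((i : ℝ) + 2) ^ s) := by
    simp only [fS]
    push_cast
    rw [Real.rpow_neg hi.le, Real.rpow_neg (by positivity), show (i : ℝ) + 1 + 1 = i + 2 by ring]
    have := Real.rpow_pos_of_pos hi s
    field_simp
  have hle : fS s i ≤ 1 / ((i : ℝ) + 1) := by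
    rw [fS, one_div, ← Real.rpow_neg_one]
    exact Real.rpow_le_rpow_of_exponent_le (by linarith [(Nat.cast_nonneg i : (0:ℝ) ≤ i)]) (by linarith)
  have h0 : 0 < fS s i := Real.rpow_pos_of_pos hi _
  have hanti : fS s (i + 1) ≤ fS s i := by
    simp only [fS]
    push_cast
    exact Real.rpow_le_rpow_of_nonpos hi (by linarith) (by linarith)
  rw [abs_of_nonneg (by linarith), hf]
  calc fS s i - fS s i * (((i : ℝ) + 1) ^ s / ((i : ℝ) + 2) ^ s)
      = fS s i * (1 - ((i : ℝ) + 1) ^ s / ((i : ℝ) + 2) ^ s) := by ring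
    _ ≤ fS s i * (s / (i + 2)) := by
        gcongr
        have : s * (-1 / ((i : ℝ) + 2)) = - (s / (i + 2)) := by ring
        linarith
    _ ≤ (1 / ((i : ℝ) + 1)) * (2 / (i + 1)) := by
        gcongr
        linarith
    _ = 2 / ((i : ℝ) + 1) ^ 2 := by field_simp

noncomputable def chG (χ : DirichletCharacter ℂ p) (s : ℝ) : ℂ :=
  ∑' i : ℕ, ((fS s i - fS s (i + 1) : ℝ) : ℂ) * chB χ (i + 1)

lemma summable_bd : Summable (fun i : ℕ => 2 / ((i : ℝ) + 1) ^ 2 * p) := by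
  have := (summable_nat_add_iff 1).2 (Real.summable_one_div_nat_pow.2 (one_lt_two))
  refine (this.mul_left (2 * (p:ℝ))).congr fun i => ?_
  push_cast
  ring

lemma term_bd (χ : DirichletCharacter ℂ p) (hχ : χ ≠ 1) {s : ℝ} (h1 : 1 ≤ s) (h2 : s ≤ 2) (i : ℕ) :
    ‖((fS s i - fS s (i + 1) : ℝ) : ℂ) * chB χ (i + 1)‖ ≤ 2 / ((i : ℝ) + 1) ^ 2 * p := by
  rw [norm_mul, Complex.norm_real, Real.norm_eq_abs]
  have := fS_diff h1 h2 i
  have := chB_bdd χ hχ (i + 1)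
  gcongr

lemma partial_tendsto (χ : DirichletCharacter ℂ p) (hχ : χ ≠ 1) {s : ℝ} (h1 : 1 ≤ s) (h2 : s ≤ 2) :
    Tendsto (fun N => ∑ i ∈ Finset.range N, (fS s i : ℂ) * χ ((i + 1 : ℕ) : ZMod p)) atTop
      (𝓝 (chG χ s)) := by
  simp_rw [parts]
  rw [← zero_add (chG χ s)]
  apply Tendsto.add
  · have : Tendsto (fun N => fS s N * (p : ℝ)) atTop (𝓝 0) := by
      rw [← zero_mul (p : ℝ)]
      refine Tendsto.mul_const _ ?_
      exact (tendsto_rpow_neg_atTop (by linarith : 0 < s)).comp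
        (tendsto_atTop_add_const_right _ _ tendsto_natCast_atTop_atTop)
    refine squeeze_zero_norm (fun N => ?_) this
    rw [norm_mul, Complex.norm_real, Real.norm_eq_abs,
      abs_of_nonneg (show 0 ≤ fS s N from Real.rpow_nonneg (by positivity) _)]
    have := chB_bdd χ hχ N
    have : 0 ≤ fS s N := (Real.rpow_nonneg (by positivity) _)
    gcongr
  · exact (Summable.of_norm_bounded summable_bd (term_bd χ hχ h1 h2)).hasSum.tendsto_sum_nat

lemma chG_cont (χ : DirichletCharacter ℂ p) (hχ : χ ≠ 1) : ContinuousOn (chG χ) (Set.Icc 1 2) := by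
  refine continuousOn_tsum (u := fun i : ℕ => 2 / ((i : ℝ) + 1) ^ 2 * p) ?_ summable_bd ?_
  · intro i
    apply Continuous.continuousOn
    have : ∀ j, Continuous (fun s => fS s j) := by
      intro j
      exact Continuous.rpow continuous_const continuous_neg (fun s => Or.inl (by positivity))
    have h1 := this i
    have h2 := this (i + 1)
    fun_prop
  · intro i s hs
    exact term_bd χ hχ hs.1 hs.2 i

lemma chG_eq (χ : DirichletCharacter ℂ p) (hχ : χ ≠ 1) {s : ℝ} (h1 : 1 < s) (h2 : s ≤ 2) :
    chG χ s = DirichletCharacter.LFunction χ s := by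
  have hs' : 1 < (s : ℂ).re := by simpa using h1
  have hsum : Summable (fun n => LSeries.term (fun n => χ n) s n) :=
    DirichletCharacter.LSeriesSummable_of_one_lt_re χ hs'
  rw [DirichletCharacter.LFunction_eq_LSeries χ hs', LSeries, hsum.tsum_eq_zero_add]
  simp only [LSeries.term_zero, zero_add]
  have h3 := ((summable_nat_add_iff 1).2 hsum).hasSum.tendsto_sum_nat
  refine tendsto_nhds_unique (partial_tendsto χ hχ h1.le h2) (h3.congr fun N => ?_)
  refine Finset.sum_congr rfl fun i _ => ?_
  rw [LSeries.term_of_ne_zero (by simp), fS, Complex.ofReal_cpow (by positivity)]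
  push_cast
  rw [Complex.cpow_neg]
  field_simp

lemma LFunction_one (χ : DirichletCharacter ℂ p) (hχ : χ ≠ 1) :
    chG χ 1 = DirichletCharacter.LFunction χ 1 := by
  have hc := (DirichletCharacter.differentiable_LFunction hχ).continuous
  have t1 : Tendsto (fun s : ℝ => DirichletCharacter.LFunction χ s) (𝓝[>] 1)
      (𝓝 (DirichletCharacter.LFunction χ 1)) := by
    have := ((hc.comp Complex.continuous_ofReal).tendsto 1).mono_left
      (nhdsWithin_le_nhds (s := Set.Ioi 1))
    rw [Function.comp_apply, Complex.ofReal_one] at this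
    exact this
  have t2 : Tendsto (chG χ) (𝓝[>] 1) (𝓝 (chG χ 1)) := by
    have h := (chG_cont χ hχ) 1 (by norm_num)
    refine h.mono_left ?_
    rw [← nhdsWithin_Ioc_eq_nhdsGT (show (1:ℝ) < 2 by norm_num)]
    exact nhdsWithin_mono _ Set.Ioc_subset_Icc_self
  refine tendsto_nhds_unique t2 (t1.congr' ?_)
  filter_upwards [Ioc_mem_nhdsGT (show (1:ℝ) < 2 by norm_num)] with s hs
  exact (chG_eq χ hχ hs.1 hs.2).symm

end
end

section
open Filter Topology

section
variable {p : ℕ} [hp : Fact p.Prime]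

noncomputable def eP (j : ZMod p) : ℂ := ZMod.stdAddChar j

lemma eP_pow (j : ZMod p) (n : ℕ) : eP j ^ n = eP (j * (n : ZMod p)) := by
  rw [eP, eP, ← AddChar.map_nsmul_eq_pow, nsmul_eq_mul, mul_comm]

lemma eP_norm (j : ZMod p) : ‖eP j‖ = 1 := by
  rw [eP]; exact AddChar.norm_apply _ _

lemma eP_ne_one {j : ZMod p} (hj : j ≠ 0) : eP j ≠ 1 := by
  intro h
  apply hj
  apply ZMod.injective_stdAddChar
  rw [← eP, h, AddChar.map_zero_eq_one]

lemma eP_slit {j : ZMod p} (hj : j ≠ 0) : 0 < (1 - eP j).re := by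
  have h1 := eP_norm j
  have h2 := Complex.re_le_norm (eP j)
  rw [h1] at h2
  simp only [Complex.sub_re, Complex.one_re, sub_pos]
  refine lt_of_le_of_ne h2 fun h => eP_ne_one hj ?_
  have h3 := Complex.normSq_apply (eP j)
  rw [Complex.normSq_eq_norm_sq, h1, h] at h3
  apply Complex.ext
  · simpa using h
  · simp only [Complex.one_im]; nlinarith

lemma chi_prim (χ : DirichletCharacter ℂ p) (hχ : χ ≠ 1) : χ.IsPrimitive := by
  rw [DirichletCharacter.isPrimitive_def]
  rcases (Nat.dvd_prime hp.out).1 χ.conductor_dvd_level with h | h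
  · exact absurd (DirichletCharacter.eq_one_iff_conductor_eq_one.2 h) hχ
  · exact h

lemma chi_expand (χ : DirichletCharacter ℂ p) (hχ : χ ≠ 1) (n : ℕ) :
    χ (n : ZMod p) = ∑ j, (χ⁻¹ (-j) * gaussSum χ ZMod.stdAddChar / p) * eP j ^ n := by
  have h := (ZMod.dft (N := p) (E := ℂ)).symm_apply_apply χ
  have h1 := congrFun h (n : ZMod p)
  rw [← h1, ZMod.invDFT_apply, smul_eq_mul, Finset.mul_sum]
  refine Finset.sum_congr rfl fun j _ => ?_
  rw [(chi_prim χ hχ).fourierTransform_eq_inv_mul_gaussSum, eP_pow, eP, smul_eq_mul]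
  ring

lemma LFunction_one_log (χ : DirichletCharacter ℂ p) (hχ : χ ≠ 1) :
    DirichletCharacter.LFunction χ 1 =
      ∑ j, (χ⁻¹ (-j) * gaussSum χ ZMod.stdAddChar / p) * (-Complex.log (1 - eP j)) := by
  set c : ZMod p → ℂ := fun j => χ⁻¹ (-j) * gaussSum χ ZMod.stdAddChar / p with hc
  have hpart : Tendsto (fun N => ∑ i ∈ Finset.range N, χ (i : ZMod p) / (i : ℂ)) atTop
      (𝓝 (DirichletCharacter.LFunction χ 1)) := by
    rw [← tendsto_add_atTop_iff_nat 1, ← LFunction_one χ hχ]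
    refine (partial_tendsto χ hχ le_rfl one_le_two).congr fun N => ?_
    rw [Finset.sum_range_succ']
    simp only [Nat.cast_zero, div_zero, add_zero]
    refine Finset.sum_congr rfl fun i _ => ?_
    rw [fS, Real.rpow_neg_one]
    push_cast
    rw [div_eq_mul_inv, mul_comm]
  have hab := Complex.tendsto_tsum_powerSeries_nhdsWithin_lt hpart
  rw [tendsto_map'_iff] at hab
  have hlim : Tendsto (fun x : ℝ => ∑ j, c j * (-Complex.log (1 - eP j * x))) (𝓝[<] 1)
      (𝓝 (∑ j, c j * (-Complex.log (1 - eP j)))) := by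
    apply tendsto_finsetSum
    intro j _
    by_cases hj : j = 0
    · have : c j = 0 := by
        simp only [hc, hj, neg_zero]
        rw [MulChar.map_nonunit _ not_isUnit_zero]
        simp
      simp only [this, zero_mul]
      exact tendsto_const_nhds
    · apply Tendsto.const_mul
      apply Tendsto.neg
      have hsl : (1 - eP j * ((1 : ℝ) : ℂ)) ∈ Complex.slitPlane := by
        left
        simpa using eP_slit hj
      have h1 : ContinuousAt (fun x : ℝ => Complex.log (1 - eP j * (x : ℂ))) 1 := by
        refine ContinuousAt.clog ?_ hsl
        fun_prop
      have := h1.tendsto.mono_left (nhdsWithin_le_nhds (s := Set.Iio 1))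
      simpa using this
  refine tendsto_nhds_unique hab (hlim.congr' ?_)
  filter_upwards [Ioo_mem_nhdsLT (show (0:ℝ) < 1 by norm_num)] with x hx
  symm
  simp only [Function.comp_apply]
  apply HasSum.tsum_eq
  have hj : ∀ j : ZMod p, HasSum (fun n : ℕ => c j * ((eP j * (x : ℂ)) ^ n / n))
      (c j * (-Complex.log (1 - eP j * x))) := by
    intro j
    apply HasSum.mul_left
    apply Complex.hasSum_taylorSeries_neg_log
    rw [norm_mul, eP_norm, one_mul, Complex.norm_real, Real.norm_eq_abs, abs_of_pos hx.1]
    exact hx.2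
  have hfin := hasSum_sum (s := Finset.univ) fun j _ => hj j
  refine hfin.congr_fun fun n => ?_
  rw [chi_expand χ hχ n, Finset.sum_div, Finset.sum_mul]
  refine Finset.sum_congr rfl fun j _ => ?_
  rw [mul_pow]
  ring

lemma norm_gauss (χ : DirichletCharacter ℂ p) (hχ : χ ≠ 1) :
    ‖gaussSum χ ZMod.stdAddChar‖ = √p := by
  have h := gaussSum_mul_gaussSum_eq_card hχ (ZMod.isPrimitive_stdAddChar p)
  have h2 := star_gaussSum_eq χ (ZMod.stdAddChar (N := p))
  rw [← h2, ← starRingEnd_apply, Complex.mul_conj, Complex.normSq_eq_norm_sq, ZMod.card] at h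
  have h3 : ‖gaussSum χ ZMod.stdAddChar‖ ^ 2 = (p : ℝ) := by exact_mod_cast h
  rw [← h3, Real.sqrt_sq (norm_nonneg _)]

lemma norm_LFunction_one (χ : DirichletCharacter ℂ p) (hχ : χ ≠ 1) (hev : χ (-1) = 1) :
    ‖DirichletCharacter.LFunction χ 1‖ =
      ‖∑ j, χ⁻¹ j * (Real.log ‖1 - eP j‖ : ℂ)‖ / √p := by
  have hev2 : ∀ j : ZMod p, χ⁻¹ (-j) = χ⁻¹ j := by
    intro j
    have : χ⁻¹ (-1) = 1 := by
      rw [MulChar.inv_apply_eq_inv, hev, Ring.inverse_one]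
    rw [← neg_one_mul, map_mul, this, one_mul]
  have hneg : ∀ j : ZMod p, eP (-j) = starRingEnd ℂ (eP j) := by
    intro j
    rw [eP, eP, AddChar.map_neg_eq_conj]
  have hS1 : ∑ j, χ⁻¹ j * Complex.log (1 - eP j) =
      ∑ j, χ⁻¹ j * starRingEnd ℂ (Complex.log (1 - eP j)) := by
    rw [← Equiv.sum_comp (Equiv.neg (ZMod p))]
    refine Finset.sum_congr rfl fun j _ => ?_
    rw [Equiv.neg_apply, hev2, hneg]
    by_cases hj : j = 0
    · rw [hj, MulChar.map_nonunit _ not_isUnit_zero]; simp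
    · rw [← Complex.log_conj, map_sub, map_one]
      intro h
      have h1 := eP_slit hj
      rw [Complex.arg_eq_pi_iff] at h
      linarith [h.1]
  have hS : ∑ j, χ⁻¹ j * Complex.log (1 - eP j) = ∑ j, χ⁻¹ j * (Real.log ‖1 - eP j‖ : ℂ) := by
    have h2 : (2 : ℂ) * ∑ j, χ⁻¹ j * Complex.log (1 - eP j) =
        2 * ∑ j, χ⁻¹ j * (Real.log ‖1 - eP j‖ : ℂ) := by
      rw [two_mul]
      nth_rewrite 2 [hS1]
      rw [← Finset.sum_add_distrib, Finset.mul_sum]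
      refine Finset.sum_congr rfl fun j _ => ?_
      rw [← mul_add, Complex.add_conj, Complex.log_re]
      push_cast
      ring
    exact mul_left_cancel₀ two_ne_zero h2
  have hmain : DirichletCharacter.LFunction χ 1 =
      -(gaussSum χ ZMod.stdAddChar / p) * ∑ j, χ⁻¹ j * (Real.log ‖1 - eP j‖ : ℂ) := by
    rw [LFunction_one_log χ hχ, ← hS, Finset.mul_sum]
    refine Finset.sum_congr rfl fun j _ => ?_
    rw [hev2]
    ring
  rw [hmain, norm_mul, norm_neg, norm_div, norm_gauss χ hχ, Complex.norm_natCast]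
  have hp0 : (0 : ℝ) < p := by exact_mod_cast hp.out.pos
  have : √(p : ℝ) * √p = p := Real.mul_self_sqrt hp0.le
  have h3 : 0 < √(p : ℝ) := Real.sqrt_pos.2 hp0
  have h4 : √(p : ℝ) / p = 1 / √p := by
    rw [div_eq_div_iff hp0.ne' h3.ne', this, one_mul]
  rw [h4]
  ring
end
end

section
set_option linter.unusedSectionVars false
open NumberField Ideal

section
variable {p : ℕ} [hp : Fact p.Prime] (K : Type*) [Field K] [NumberField K]
  [IsCyclotomicExtension {p} ℚ K] [IsCMField K]
local notation "K⁺" => maximalRealSubfield K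

lemma absNorm_prim {η : 𝓞 K} (hη : IsPrimitiveRoot η p) : absNorm (span {η - 1}) = p := by
  have h1 : IsPrimitiveRoot (η : K) (p ^ (0 + 1)) := by
    simpa using hη.map_of_injective (f := algebraMap (𝓞 K) K) RingOfIntegers.coe_injective
  have : IsCyclotomicExtension {p ^ (0 + 1)} ℚ K := by simpa
  have := IsCyclotomicExtension.Rat.absNorm_span_zeta_sub_one p 0 h1
  convert this using 4
  congr 1

lemma prim_exists : ∃ η : 𝓞 K, IsPrimitiveRoot η p := by
  have : NeZero p := ⟨hp.out.ne_zero⟩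
  exact ⟨_, (IsCyclotomicExtension.zeta_spec p ℚ K).toInteger_isPrimitiveRoot⟩

lemma adjoin_top {η : 𝓞 K} (hη : IsPrimitiveRoot η p) :
    Algebra.adjoin K⁺ {algebraMap (𝓞 K) K η} = ⊤ := by
  have : NeZero p := ⟨hp.out.ne_zero⟩
  have h1 : IsPrimitiveRoot (η : K) p :=
    hη.map_of_injective (f := algebraMap (𝓞 K) K) RingOfIntegers.coe_injective
  have h2 := IsCyclotomicExtension.adjoin_primitive_root_eq_top (A := ℚ) h1
  rw [eq_top_iff]
  intro x _
  have hx : x ∈ Algebra.adjoin ℚ {(η : K)} := by rw [h2]; trivial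
  have : Algebra.adjoin ℚ {(η : K)} ≤ (Algebra.adjoin K⁺ {algebraMap (𝓞 K) K η}).restrictScalars ℚ := by
    apply Algebra.adjoin_le
    exact Algebra.subset_adjoin
  exact this hx

lemma sub_inv_mem (hp2 : p ≠ 2) {η : 𝓞 K} (hη : IsPrimitiveRoot η p) :
    η - IsCMField.ringOfIntegersComplexConj K η ∈ differentIdeal (𝓞 K⁺) (𝓞 K) := by
  have hc := conj_prim K hη
  set c := IsCMField.ringOfIntegersComplexConj K η with hcdef
  have htr : IsCMField.ringOfIntegersComplexConj K (η + c) = η + c := by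
    rw [map_add, hcdef, add_comm]
    congr 1
    apply RingOfIntegers.ext
    simp [IsCMField.coe_ringOfIntegersComplexConj]
  rw [IsCMField.ringOfIntegersComplexConj_eq_self_iff] at htr
  obtain ⟨t, ht⟩ := htr
  have hmin : minpoly (𝓞 K⁺) η = Polynomial.X ^ 2 - Polynomial.C t * Polynomial.X + 1 := by
    have hq : (Polynomial.X ^ 2 - Polynomial.C t * Polynomial.X + 1 : Polynomial (𝓞 K⁺)).natDegree = 2 := by
      compute_degree!
    have hm : (Polynomial.X ^ 2 - Polynomial.C t * Polynomial.X + 1 : Polynomial (𝓞 K⁺)).Monic := by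
      monicity!
    have hIntg : IsIntegral (𝓞 K⁺) η := Algebra.IsIntegral.isIntegral η
    refine (Polynomial.eq_of_monic_of_dvd_of_natDegree_le (minpoly.monic hIntg) hm ?_ ?_).symm
    · apply minpoly.isIntegrallyClosed_dvd hIntg
      simp only [map_add, map_sub, map_mul, map_pow, Polynomial.aeval_X, Polynomial.aeval_C, map_one, ht]
      linear_combination - hc
    · rw [hq, minpoly.two_le_natDegree_iff hIntg]
      intro h
      have h' := (IsCMField.ringOfIntegersComplexConj_eq_self_iff K η).2 h
      rw [← hcdef] at h'
      rw [h', ← pow_two] at hc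
      have := hη.dvd_of_pow_eq_one _ hc
      exact hp2 ((Nat.prime_dvd_prime_iff_eq hp.out Nat.prime_two).1 this)
  have := aeval_derivative_mem_differentIdeal (𝓞 K⁺) K⁺ K η (adjoin_top K hη)
  rw [hmin] at this
  convert this using 1
  simp [ht]
  ring

lemma discr_real (hp2 : p ≠ 2) : (discr K⁺).natAbs = p ^ ((p - 3) / 2) := by
  obtain ⟨η, hη⟩ := prim_exists (p := p) K
  have h3 : 3 ≤ p := by have := hp.out.two_le; omega
  have hpo : p % 2 = 1 := by
    rcases hp.out.eq_two_or_odd with h | h <;> omega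
  have h1 := natAbs_discr_eq_absNorm_differentIdeal_mul_natAbs_discr_pow K⁺ (𝓞 K⁺) K (𝓞 K)
  rw [IsCyclotomicExtension.Rat.discr_prime p K, Algebra.IsQuadraticExtension.finrank_eq_two K⁺ K] at h1
  have h2 : absNorm (differentIdeal (𝓞 K⁺) (𝓞 K)) ∣ p := by
    have hη2 : IsPrimitiveRoot (η ^ 2) p := by
      apply hη.pow_of_coprime
      exact (Nat.coprime_primes Nat.prime_two hp.out).2 (Ne.symm hp2)
    rw [← absNorm_prim K hη2]
    apply absNorm_dvd_absNorm_of_le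
    rw [span_singleton_le_iff_mem]
    have := Ideal.mul_mem_left _ η (sub_inv_mem K hp2 hη)
    have hc := conj_prim K hη
    convert this using 1
    linear_combination hc
  simp [Int.natAbs_mul, Int.natAbs_pow] at h1
  rcases (Nat.dvd_prime hp.out).1 h2 with h | h
  · exfalso
    rw [h, one_mul] at h1
    have := congrArg (fun n => n.factorization p) h1
    simp [hp.out.factorization_self] at this
    omega
  · rw [h] at h1
    have : p ^ (p - 2) = p * (p ^ ((p-3)/2)) ^ 2 := by
      rw [← pow_mul, ← pow_succ']
      congr 1
      omega
    rw [this] at h1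
    have h4 := Nat.eq_of_mul_eq_mul_left hp.out.pos h1
    exact (Nat.pow_left_injective two_ne_zero h4).symm
end
end

section
set_option linter.unusedSectionVars false
open NumberField Ideal

lemma torsionOrder_real (F : Type*) [Field F] [NumberField F] [h : IsTotallyReal F] :
    Units.torsionOrder F = 2 := by
  have hr : 0 < InfinitePlace.nrRealPlaces F := by
    rw [← IsTotallyReal.finrank F]; exact Module.finrank_pos
  have key : ∀ x : Units.torsion F, (x : (𝓞 F)ˣ) = 1 ∨ (x : (𝓞 F)ˣ) = -1 := by
    intro x
    by_cases! hc : 2 < orderOf (x : (𝓞 F)ˣ)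
    · rw [← orderOf_units] at hc
      have h1 : IsPrimitiveRoot (((x : (𝓞 F)ˣ) : 𝓞 F) : F) (orderOf ((x : (𝓞 F)ˣ) : 𝓞 F)) :=
        (IsPrimitiveRoot.orderOf _).map_of_injective (f := algebraMap (𝓞 F) F)
          RingOfIntegers.coe_injective
      have := NumberField.InfinitePlace.IsPrimitiveRoot.nrRealPlaces_eq_zero_of_two_lt hc h1
      omega
    · interval_cases hi : orderOf (x : (𝓞 F)ˣ)
      · linarith [orderOf_pos_iff.2 ((CommGroup.mem_torsion x.1).1 x.2)]
      · exact Or.intro_left _ (orderOf_eq_one_iff.1 hi)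
      · rw [← orderOf_units, CharP.orderOf_eq_two_iff 0 (by decide)] at hi
        simp [← Units.val_inj, Units.val_neg, Units.val_one, hi]
  classical
  have := Fintype.ofFinite (Units.torsion F)
  rw [Units.torsionOrder, Nat.card_eq_fintype_card]
  refine (Finset.card_eq_two.2 ⟨1, ⟨-1, neg_one_mem_torsion⟩,
    by simp [← Subtype.coe_ne_coe], Finset.ext fun x ↦ ⟨fun _ ↦ ?_, fun _ ↦ Finset.mem_univ _⟩⟩)
  rw [Finset.mem_insert, Finset.mem_singleton, ← Subtype.val_inj, ← Subtype.val_inj]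
  exact key x

section
variable {p : ℕ} [hp : Fact p.Prime] (K : Type*) [Field K] [NumberField K]
  [IsCyclotomicExtension {p} ℚ K] [IsCMField K]
local notation "K⁺" => maximalRealSubfield K

/-- character sum of logs -/
noncomputable def SS (χ : DirichletCharacter ℂ p) : ℂ :=
  ∑ j : ZMod p, χ j * (Real.log ‖1 - eP j‖ : ℂ)

open Classical in
lemma class_formula (hp2 : p ≠ 2) :
    (2 : ℝ) ^ ((p - 3) / 2) * Units.regulator K⁺ * classNumber K⁺ =
      ∏ χ ∈ (evenChars p).erase 1, ‖SS χ‖ := by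
  have h3 : 3 ≤ p := by have := hp.out.two_le; omega
  have hpo : p % 2 = 1 := by
    rcases hp.out.eq_two_or_odd with h | h <;> omega
  have hpp : (0 : ℝ) < p := by exact_mod_cast hp.out.pos
  have h1 := congrArg norm (residue_eq K hp2)
  rw [norm_prod, Complex.norm_real, Real.norm_of_nonneg (dedekindZeta_residue_pos K⁺).le,
    dedekindZeta_residue_def, ← IsTotallyReal.finrank, finrank_real (p := p) K,
    IsTotallyReal.nrComplexPlaces_eq_zero, torsionOrder_real] at h1
  have h2 : ∏ χ ∈ (evenChars p).erase 1, ‖DirichletCharacter.LFunction χ 1‖ =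
      ∏ χ ∈ (evenChars p).erase 1, (‖SS χ⁻¹‖ / √p) := by
    refine Finset.prod_congr rfl fun χ hχ => ?_
    rw [Finset.mem_erase, mem_evenChars] at hχ
    rw [norm_LFunction_one χ hχ.1 hχ.2, SS]
  have h4 : ∏ χ ∈ (evenChars p).erase 1, ‖SS χ⁻¹‖ = ∏ χ ∈ (evenChars p).erase 1, ‖SS χ‖ := by
    have hm : ∀ χ : DirichletCharacter ℂ p, χ ∈ (evenChars p).erase 1 → χ⁻¹ ∈ (evenChars p).erase 1 := by
      intro χ hχ
      rw [Finset.mem_erase, mem_evenChars] at hχ ⊢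
      refine ⟨inv_ne_one.2 hχ.1, ?_⟩
      rw [MulChar.inv_apply_eq_inv', hχ.2, inv_one]
    refine Finset.prod_nbij' (fun χ => χ⁻¹) (fun χ => χ⁻¹) hm hm ?_ ?_ ?_ <;> simp
  rw [h2, Finset.prod_div_distrib, h4, Finset.prod_const,
    Finset.card_erase_of_mem one_mem_evenChars, card_evenChars hp2] at h1
  have h5 : √(|discr K⁺| : ℤ) = √p ^ ((p - 1) / 2 - 1) := by
    have : (|discr K⁺| : ℤ) = ((discr K⁺).natAbs : ℤ) := by simp
    rw [this, discr_real K hp2]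
    push_cast
    rw [Real.sqrt_eq_iff_mul_self_eq (by positivity) (by positivity), ← mul_pow, Real.mul_self_sqrt hpp.le]
    congr 1; omega
  push_cast at h5 h1
  rw [h5] at h1
  have h6 : (0 : ℝ) < √p ^ ((p - 1) / 2 - 1) := by positivity
  rw [div_eq_div_iff (by positivity) h6.ne'] at h1
  have h7 : (p - 1) / 2 = (p - 3) / 2 + 1 := by omega
  have h8 := mul_right_cancel₀ h6.ne' (h1.trans (by ring : _ = ((∏ χ ∈ (evenChars p).erase 1, ‖SS χ‖) * 2) * √p ^ ((p - 1) / 2 - 1) ))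
  rw [h7, pow_succ, pow_zero] at h8
  linarith
end
end

section
set_option linter.unusedSectionVars false
open Matrix

section
variable {P : Type*} [Fintype P] [DecidableEq P]

lemma det_T (w' : P) : (Matrix.of fun i w : P => if i = w' then (2 : ℂ) else
      if w = i then 1 else if w = w' then -1 else 0).det = 2 * Fintype.card P := by
  set T := (Matrix.of fun i w : P => if i = w' then (2 : ℂ) else
      if w = i then 1 else if w = w' then -1 else 0) with hT
  let U : Matrix P P ℂ := Matrix.of fun w v => if v = w' then 1 else if w = v then 1 else 0
  have hU : U.det = 1 := by
    rw [twoBlockTriangular_det' U (· = w')]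
    · have h1 : toSquareBlockProp U (· = w') = 1 := by
        ext ⟨i, hi⟩ ⟨j, hj⟩
        subst hi
        subst hj
        simp [toSquareBlockProp_def, U]
      have h2 : toSquareBlockProp U (fun i => ¬ i = w') = 1 := by
        ext ⟨i, hi⟩ ⟨j, hj⟩
        simp [toSquareBlockProp_def, U, hj, Matrix.one_apply]
      rw [h1, h2]; simp
    · intro i hi j hj
      subst hi
      simp [U, hj, Ne.symm hj]
  have hTU : (T * U).det = 2 * Fintype.card P := by
    have hrow : ∀ i, i ≠ w' → ∀ j, (T * U) i j = if i = j then 1 else 0 := by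
      intro i hi j
      simp only [Matrix.mul_apply, T, U, Matrix.of_apply, if_neg hi]
      have : ∀ x : P, (if x = i then (1:ℂ) else if x = w' then -1 else 0) =
          (if x = i then 1 else 0) - (if x = w' then 1 else 0) := by
        intro x
        by_cases h1 : x = i
        · subst h1; simp [hi]
        · simp [h1]; split_ifs <;> simp
      simp only [this]
      by_cases hj : j = w'
      · subst hj; simp [hi]
      · simp [hj]
        simp only [eq_comm]
    rw [twoBlockTriangular_det (T * U) (· = w')]
    · have h2 : toSquareBlockProp (T * U) (fun i => ¬ i = w') = 1 := by
        ext ⟨i, hi⟩ ⟨j, hj⟩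
        simp [toSquareBlockProp_def, Matrix.one_apply, hrow i hi j]
      rw [h2, det_one, mul_one]
      have hss : Subsingleton {x // x = w'} := ⟨fun x y => Subtype.ext (x.2.trans y.2.symm)⟩
      have hd := det_eq_elem_of_subsingleton (toSquareBlockProp (T * U) (· = w')) ⟨w', rfl⟩
      have hv : toSquareBlockProp (T * U) (· = w') ⟨w', rfl⟩ ⟨w', rfl⟩ = 2 * Fintype.card P := by
        simp [toSquareBlockProp_def, Matrix.mul_apply, T, U, mul_comm]
      rw [hv] at hd
      convert hd
    · intro i hi j hj
      rw [hrow i hi j, if_neg]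
      rintro rfl; exact hi hj
  rw [det_mul, hU, mul_one] at hTU
  exact hTU

variable {p : ℕ} [hp : Fact p.Prime]

lemma chi_inv_star (χ : DirichletCharacter ℂ p) (a : (ZMod p)ˣ) :
    χ ((a⁻¹ : (ZMod p)ˣ) : ZMod p) = star (χ a) := by
  rw [← MulChar.star_apply, MulChar.star_eq_inv, MulChar.inv_apply, Ring.inverse_unit]

lemma eP_neg (j : ZMod p) : eP (-j) = star (eP j) := by
  unfold eP
  rw [AddChar.map_neg_eq_conj]; rfl

lemma norm_one_sub_neg (j : ZMod p) : ‖1 - eP (-j)‖ = ‖1 - eP j‖ := by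
  rw [eP_neg, ← norm_star (1 - eP j)]
  simp

lemma sum_places (hp2 : p ≠ 2) (a : P → (ZMod p)ˣ)
    (hinj : ∀ v w, (a v = a w ∨ a v = - a w) → v = w) (hcard : Fintype.card P = (p - 1) / 2)
    (f : (ZMod p)ˣ → ℂ) (hf : ∀ j, f (-j) = f j) : 2 * ∑ w, f (a w) = ∑ j, f j := by
  have hpo : p % 2 = 1 := by
    rcases hp.out.eq_two_or_odd with h | h <;> omega
  have hne : ∀ x : (ZMod p)ˣ, x ≠ -x := by
    intro x h
    have h2 : (x : ZMod p) = -x := by exact_mod_cast congrArg Units.val h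
    have h3 : (2 : ZMod p) * x = 0 := by linear_combination h2
    rcases mul_eq_zero.1 h3 with h4 | h4
    · have : ((2 : ℕ) : ZMod p) = 0 := by exact_mod_cast h4
      rw [ZMod.natCast_eq_zero_iff] at this
      exact hp2 ((Nat.prime_dvd_prime_iff_eq hp.out Nat.prime_two).1 this)
    · exact x.ne_zero h4
  let g : P ⊕ P → (ZMod p)ˣ := Sum.elim a (fun w => - a w)
  have hg : Function.Bijective g := by
    rw [Fintype.bijective_iff_injective_and_card]
    constructor
    · rintro (v | v) (w | w) h
      · simp only [g, Sum.elim_inl] at h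
        rw [hinj v w (Or.inl h)]
      · simp only [g, Sum.elim_inl, Sum.elim_inr] at h
        have := hinj v w (Or.inr h)
        subst this
        exact absurd h (hne _)
      · simp only [g, Sum.elim_inl, Sum.elim_inr] at h
        have := hinj w v (Or.inr h.symm)
        subst this
        exact absurd h.symm (hne _)
      · simp only [g, Sum.elim_inr, neg_inj] at h
        rw [hinj v w (Or.inl h)]
    · rw [Fintype.card_sum, hcard, ZMod.card_units]
      omega
  rw [← Equiv.sum_comp (Equiv.ofBijective g hg)]
  simp [g, hf, two_mul]

lemma sum_units_eq (χ : DirichletCharacter ℂ p) (g : ZMod p → ℂ) :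
    ∑ j : (ZMod p)ˣ, χ j * g j = ∑ j : ZMod p, χ j * g j := by
  refine Finset.sum_of_injOn (fun j : (ZMod p)ˣ => (j : ZMod p)) ?_ ?_ ?_ ?_
  · intro x _ y _ h; exact Units.ext h
  · intro x _; simp
  · intro i _ hi
    rw [MulChar.map_nonunit, zero_mul]
    rintro ⟨u, rfl⟩
    exact hi ⟨u, by simp, rfl⟩
  · intro i _; rfl

lemma sum_units (χ : DirichletCharacter ℂ p) (b : (ZMod p)ˣ) :
    ∑ j : (ZMod p)ˣ, χ j * (Real.log ‖1 - eP ((b * j : (ZMod p)ˣ) : ZMod p)‖ : ℂ) = star (χ b) * SS χ := by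
  rw [← chi_inv_star, SS, ← sum_units_eq χ (fun j => (Real.log ‖1 - eP j‖ : ℂ)), Finset.mul_sum,
    ← Equiv.sum_comp (Equiv.mulLeft b) (fun j => χ ((b⁻¹ : (ZMod p)ˣ) : ZMod p) *
      (χ (j : ZMod p) * (Real.log ‖1 - eP (j : ZMod p)‖ : ℂ)))]
  refine Finset.sum_congr rfl fun j _ => ?_
  rw [← mul_assoc, ← map_mul, ← Units.val_mul, Equiv.coe_mulLeft, inv_mul_cancel_left]

lemma SS_shift (hp2 : p ≠ 2) (a : P → (ZMod p)ˣ)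
    (hinj : ∀ v w, (a v = a w ∨ a v = - a w) → v = w) (hcard : Fintype.card P = (p - 1) / 2)
    (χ : DirichletCharacter ℂ p) (hχ : χ ∈ evenChars p) (b : (ZMod p)ˣ) :
    2 * ∑ w, χ (a w) * (Real.log ‖1 - eP ((b * a w : (ZMod p)ˣ) : ZMod p)‖ : ℂ) = star (χ b) * SS χ := by
  rw [mem_evenChars] at hχ
  rw [← sum_units]
  apply sum_places hp2 a hinj hcard (fun j => χ j * (Real.log ‖1 - eP ((b * j : (ZMod p)ˣ) : ZMod p)‖ : ℂ))
  intro j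
  have h1 : χ ((-j : (ZMod p)ˣ) : ZMod p) = χ j := by
    rw [Units.val_neg, neg_eq_neg_one_mul, map_mul, hχ, one_mul]
  have h2 : ((b * -j : (ZMod p)ˣ) : ZMod p) = - ((b * j : (ZMod p)ˣ) : ZMod p) := by
    rw [mul_neg, Units.val_neg]
  simp only [h1, h2, norm_one_sub_neg]

open Classical in
lemma det_main (hp2 : p ≠ 2) (a : P → (ZMod p)ˣ)
    (hinj : ∀ v w, (a v = a w ∨ a v = - a w) → v = w) (hcard : Fintype.card P = (p - 1) / 2)
    (w' : P) :
    |(Matrix.of fun i w : P => if i = w' then (2 : ℝ) else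
      2 * (Real.log ‖1 - eP ((a i * a w : (ZMod p)ˣ) : ZMod p)‖ -
        Real.log ‖1 - eP ((a w' * a w : (ZMod p)ˣ) : ZMod p)‖)).det| =
      ((p - 1 : ℕ) : ℝ) * ∏ χ ∈ (evenChars p).erase 1, ‖SS χ‖ := by
  have hpo : p % 2 = 1 := by
    rcases hp.out.eq_two_or_odd with h | h <;> omega
  set M := (Matrix.of fun i w : P => if i = w' then (2 : ℝ) else
      2 * (Real.log ‖1 - eP ((a i * a w : (ZMod p)ˣ) : ZMod p)‖ -
        Real.log ‖1 - eP ((a w' * a w : (ZMod p)ˣ) : ZMod p)‖)) with hM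
  have e : P ≃ {χ // χ ∈ evenChars p} := Fintype.equivOfCardEq (by
    rw [hcard, Fintype.card_coe, card_evenChars hp2])
  let X : Matrix P P ℂ := Matrix.of fun w c => (e c).1 (a w)
  let Y : Matrix P P ℂ := Matrix.of fun w c => star ((e c).1 (a w))
  let D : P → ℂ := fun c => if (e c).1 = 1 then 1 else SS (e c).1
  have hXY : X * Y.transpose = (((p-1)/2 : ℕ) : ℂ) • 1 := by
    ext v w
    simp only [Matrix.mul_apply, X, Y, Matrix.of_apply, Matrix.transpose_apply, Matrix.smul_apply,
      Matrix.one_apply, smul_eq_mul]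
    have h1 : ∀ c, (e c).1 (a v) * star ((e c).1 (a w)) = (e c).1 ((a v * (a w)⁻¹ : (ZMod p)ˣ) : ZMod p) := by
      intro c
      rw [← chi_inv_star, ← map_mul, Units.val_mul]
    simp only [h1]
    rw [Equiv.sum_comp e (fun χ => χ.1 ((a v * (a w)⁻¹ : (ZMod p)ˣ) : ZMod p)),
      Finset.sum_coe_sort (evenChars p) (fun χ => χ ((a v * (a w)⁻¹ : (ZMod p)ˣ) : ZMod p)), sum_evenChars hp2]
    have h2 : (a v * (a w)⁻¹ = 1 ∨ a v * (a w)⁻¹ = -1) ↔ v = w := by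
      rw [mul_inv_eq_one, mul_inv_eq_iff_eq_mul, neg_one_mul]
      refine ⟨hinj v w, ?_⟩
      rintro rfl; exact Or.inl rfl
    simp only [h2]
    split_ifs <;> simp
  have hX0 : X.det ≠ 0 := by
    intro h
    have h1 := congrArg Matrix.det hXY
    rw [det_mul, h, zero_mul, det_smul, det_one, mul_one] at h1
    have h2 : (((p-1)/2 : ℕ) : ℂ) ≠ 0 := by
      have := hp.out.two_le
      exact_mod_cast (by omega : (p - 1) / 2 ≠ 0)
    exact pow_ne_zero _ h2 h1.symm
  have hY : Y.det = star X.det := by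
    have : Y = X.map (starRingEnd ℂ) := by ext; simp [X, Y]
    rw [this]
    exact ((starRingEnd ℂ).map_det X).symm
  set T := (Matrix.of fun i w : P => if i = w' then (2 : ℂ) else
      if w = i then 1 else if w = w' then -1 else 0) with hT
  have key : M.map (algebraMap ℝ ℂ) * X = T * Y * Matrix.diagonal D := by
    have hsum1 : ∀ χ ∈ evenChars p, χ ≠ 1 → ∑ w, χ (a w) = 0 := by
      intro χ hχ h1
      rw [mem_evenChars] at hχ
      have := sum_places hp2 a hinj hcard (fun j => χ j) (by
        intro j
        rw [Units.val_neg, neg_eq_neg_one_mul, map_mul, hχ, one_mul])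
      have h2 := sum_units_eq χ (fun _ => 1)
      simp only [mul_one] at h2
      rw [h2, MulChar.sum_eq_zero_of_ne_one h1] at this
      simpa using this
    ext i c
    rw [Matrix.mul_diagonal]
    simp only [Matrix.mul_apply, Matrix.map_apply, hM, hT, Matrix.of_apply, X, Y, D]
    by_cases hi : i = w'
    · simp only [if_pos hi]
      by_cases h1 : (e c).1 = 1
      · simp [h1]
      · rw [if_neg h1, ← Finset.mul_sum, ← Finset.mul_sum, ← star_sum, hsum1 _ (e c).2 h1]
        simp
    · simp only [if_neg hi]
      have h3 := SS_shift hp2 a hinj hcard _ (e c).2 (a i)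
      have h4 := SS_shift hp2 a hinj hcard _ (e c).2 (a w')
      have h5 : ∀ x : P, (if x = i then (1:ℂ) else if x = w' then -1 else 0) =
          (if x = i then 1 else 0) - (if x = w' then 1 else 0) := by
        intro x
        by_cases h1 : x = i
        · subst h1; simp [hi]
        · simp [h1]; split_ifs <;> simp
      simp only [h5, sub_mul, Finset.sum_sub_distrib, ite_mul, one_mul, zero_mul,
        Finset.sum_ite_eq', Finset.sum_ite_eq, Finset.mem_univ, if_true]
      trans (star ((e c).1 (a i)) * SS (e c).1 - star ((e c).1 (a w')) * SS (e c).1)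
      · rw [← h3, ← h4, Finset.mul_sum, Finset.mul_sum, ← Finset.sum_sub_distrib]
        refine Finset.sum_congr rfl fun w _ => ?_
        simp only [Complex.coe_algebraMap]
        push_cast
        ring
      · by_cases h1 : (e c).1 = 1
        · simp [h1]
        · rw [if_neg h1]
  have hdet := congrArg (fun A => ‖Matrix.det A‖) key
  simp only [det_mul, norm_mul] at hdet
  rw [hY, norm_star, det_T, det_diagonal, mul_right_comm] at hdet
  have h6 := mul_right_cancel₀ (norm_ne_zero_iff.2 hX0) hdet
  have h7 : (M.map (algebraMap ℝ ℂ)).det = (M.det : ℂ) := ((algebraMap ℝ ℂ).map_det M).symm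
  rw [h7, Complex.norm_real, Real.norm_eq_abs] at h6
  rw [h6]
  congr 1
  · rw [hcard]
    rw [norm_mul]
    simp
    have : p - 1 = 2 * ((p - 1) / 2) := by omega
    exact_mod_cast this.symm
  · rw [norm_prod]
    rw [Equiv.prod_comp e (fun χ => ‖if χ.1 = 1 then 1 else SS χ.1‖),
      Finset.prod_coe_sort (evenChars p) (fun χ => ‖if χ = 1 then 1 else SS χ‖)]
    rw [← Finset.mul_prod_erase _ _ one_mem_evenChars]
    simp only [if_true, norm_one, one_mul]
    refine Finset.prod_congr rfl fun χ hχ => ?_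
    rw [if_neg (Finset.ne_of_mem_erase hχ)]
end
end

section
set_option linter.unusedSectionVars false
open NumberField

section
variable {p : ℕ} [hp : Fact p.Prime]

lemma cover {P : Type*} [Fintype P] (hp2 : p ≠ 2) (a : P → (ZMod p)ˣ)
    (hinj : ∀ v w, (a v = a w ∨ a v = - a w) → v = w) (hcard : Fintype.card P = (p - 1) / 2)
    (b : (ZMod p)ˣ) : ∃ w, a w = b ∨ a w = -b := by
  classical
  by_contra! h
  have := sum_places hp2 a hinj hcard (fun j => if j = b ∨ j = -b then (1 : ℂ) else 0) (by
    intro j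
    simp only [neg_eq_iff_eq_neg, neg_neg]
    congr 1
    rw [or_comm])
  simp only [Finset.sum_ite_eq, h, or_self, if_false, Finset.sum_const_zero, mul_zero] at this
  rw [Finset.sum_boole] at this
  have h2 : (Finset.univ.filter (fun j : (ZMod p)ˣ => j = b ∨ j = -b)).card = 0 := by
    exact_mod_cast this.symm
  rw [Finset.card_eq_zero] at h2
  have h3 : b ∈ (Finset.univ.filter (fun j : (ZMod p)ˣ => j = b ∨ j = -b)) := by simp
  rw [h2] at h3
  simp at h3

lemma eP_inj {i j : ZMod p} (h : eP i = eP j) : i = j := ZMod.injective_stdAddChar h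

lemma eP_prim : IsPrimitiveRoot (eP (1 : ZMod p)) p := by
  have h1 : eP (1 : ZMod p) ^ p = 1 := by
    rw [eP_pow]; simp [eP]
  have := orderOf_eq_prime h1 (eP_ne_one one_ne_zero)
  exact IsPrimitiveRoot.iff_orderOf.2 this

variable (K : Type*) [Field K] [NumberField K]
  [IsCyclotomicExtension {p} ℚ K] [IsCMField K]
local notation "K⁺" => maximalRealSubfield K

lemma exists_a {η : 𝓞 K} (hη : IsPrimitiveRoot η p) (φ : K →+* ℂ) :
    ∃ a : (ZMod p)ˣ, φ η = eP (a : ZMod p) := by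
  have : NeZero p := ⟨hp.out.ne_zero⟩
  have h1 : IsPrimitiveRoot (φ η) p :=
    hη.map_of_injective (f := φ.comp (algebraMap (𝓞 K) K))
      (φ.injective.comp RingOfIntegers.coe_injective)
  obtain ⟨i, _, hi⟩ := eP_prim.eq_pow_of_pow_eq_one h1.pow_eq_one
  rw [eP_pow, one_mul] at hi
  have : (i : ZMod p) ≠ 0 := by
    intro h
    rw [h] at hi
    have := h1.ne_one hp.out.one_lt
    exact this (by rw [← hi]; simp [eP])
  exact ⟨Units.mk0 _ this, hi.symm⟩

lemma hom_ext_prim {η : 𝓞 K} (hη : IsPrimitiveRoot η p) {φ ψ : K →+* ℂ} (h : φ η = ψ η) : φ = ψ := by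
  have : NeZero p := ⟨hp.out.ne_zero⟩
  have h1 : IsPrimitiveRoot (η : K) p :=
    hη.map_of_injective (f := algebraMap (𝓞 K) K) RingOfIntegers.coe_injective
  have h2 := IsCyclotomicExtension.adjoin_primitive_root_eq_top (A := ℚ) h1
  have h3 : φ.toRatAlgHom = ψ.toRatAlgHom := by
    apply AlgHom.ext_of_adjoin_eq_top h2
    intro x hx
    rw [Set.mem_singleton_iff] at hx
    subst hx
    exact h
  ext x
  exact congrArg (fun f : K →ₐ[ℚ] ℂ => f x) h3

lemma card_places : Fintype.card (InfinitePlace K) = (p - 1) / 2 := by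
  rw [← IsCMField.card_infinitePlace_eq_card_infinitePlace K, ← finrank_real (p := p) K,
    InfinitePlace.card_eq_nrRealPlaces_add_nrComplexPlaces, IsTotallyReal.nrComplexPlaces_eq_zero,
    ← IsTotallyReal.finrank, add_zero]

lemma unit_exists {η : 𝓞 K} (hη : IsPrimitiveRoot η p) (a b : (ZMod p)ˣ) :
    ∃ u : (𝓞 K)ˣ, (1 - η ^ (a : ZMod p).val) = u * (1 - η ^ (b : ZMod p).val) := by
  have h : ∀ a : (ZMod p)ˣ, (a : ZMod p).val.Coprime p := fun a => ZMod.val_coe_unit_coprime a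
  have h1 := hη.associated_sub_one_pow_sub_one_of_coprime (h a)
  have h2 := hη.associated_sub_one_pow_sub_one_of_coprime (h b)
  obtain ⟨u, hu⟩ := h2.symm.trans h1
  refine ⟨u, ?_⟩
  linear_combination hu

lemma index_main (hp2 : p ≠ 2) (hV : ¬ p ∣ classNumber K⁺) {η : 𝓞 K} (hη : IsPrimitiveRoot η p) :
    ∃ (k0 : (ZMod p)ˣ) (k : Fin (Units.rank K) → (ZMod p)ˣ) (u : Fin (Units.rank K) → (𝓞 K)ˣ),
      (∀ i, (1 - η ^ (k i : ZMod p).val) = u i * (1 - η ^ (k0 : ZMod p).val)) ∧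
      Units.IsMaxRank u ∧
      ¬ p ∣ (Subgroup.closure (Set.range u) ⊔ Units.torsion K).index ∧
      ∀ b : (ZMod p)ˣ, (k0 = b ∨ k0 = -b) ∨ ∃ i, k i = b ∨ k i = -b := by
  classical
  have h3 : 3 ≤ p := by have := hp.out.two_le; omega
  have hpo : p % 2 = 1 := by
    rcases hp.out.eq_two_or_odd with h | h <;> omega
  choose a ha using fun w : InfinitePlace K => exists_a K hη w.embedding
  have hcard := card_places (p := p) K
  have hinj : ∀ v w, (a v = a w ∨ a v = - a w) → v = w := by
    intro v w h
    rw [← InfinitePlace.mk_embedding v, ← InfinitePlace.mk_embedding w, InfinitePlace.mk_eq_iff]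
    rcases h with h | h
    · left
      apply hom_ext_prim K hη
      rw [ha, ha, h]
    · right
      apply hom_ext_prim K hη
      rw [ComplexEmbedding.conjugate_coe_eq, ha, ha, h, Units.val_neg, eP_neg]
      simp
  have hr : Units.rank K = (p - 3) / 2 := by rw [Units.rank, hcard]; omega
  obtain ⟨w'⟩ : Nonempty (InfinitePlace K) := inferInstance
  have e : {w // w ≠ w'} ≃ Fin (Units.rank K) := Fintype.equivOfCardEq (by
    rw [Fintype.card_fin, Fintype.card_subtype_compl, Fintype.card_subtype_eq, Units.rank])
  choose u hu using fun i => unit_exists K hη (a (e.symm i).1) (a w')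
  have hplace : ∀ (w : InfinitePlace K) (b : (ZMod p)ˣ),
      w ((1 - η ^ (b : ZMod p).val : 𝓞 K) : K) = ‖1 - eP ((b * a w : (ZMod p)ˣ) : ZMod p)‖ := by
    intro w b
    rw [← InfinitePlace.norm_embedding_eq]
    congr 1
    push_cast
    rw [map_sub, map_pow, map_one, ha, eP_pow]
    simp [mul_comm]
  have hpos : ∀ b : (ZMod p)ˣ, ‖1 - eP (b : ZMod p)‖ ≠ 0 := by
    intro b h
    rw [norm_eq_zero, sub_eq_zero] at h
    exact eP_ne_one b.ne_zero h.symm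
  have hreg : Units.regOfFamily u = ∏ χ ∈ (evenChars p).erase 1, ‖SS χ‖ := by
    have h1 := Units.finrank_mul_regOfFamily_eq_det u w' e
    have h2 := det_main hp2 a hinj hcard w'
    have h4 : Module.finrank ℚ K = p - 1 := by
      have : NeZero p := ⟨hp.out.ne_zero⟩
      rw [IsCyclotomicExtension.finrank (n := p) K (Polynomial.cyclotomic.irreducible_rat hp.out.pos),
        Nat.totient_prime hp.out]
    have h5 : ((p - 1 : ℕ) : ℝ) ≠ 0 := by exact_mod_cast (by omega : p - 1 ≠ 0)
    apply mul_left_cancel₀ h5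
    rw [← h2, ← h4, h1]
    congr 3
    ext i w
    have hmult : w.mult = 2 := InfinitePlace.mult_isComplex ⟨w, IsTotallyComplex.isComplex w⟩
    by_cases h : i = w'
    · simp [h, hmult]
    · simp only [h, hmult, dif_neg, not_false_eq_true, if_false, Matrix.of_apply, Nat.cast_ofNat]
      congr 1
      have h6 := congrArg (fun x : 𝓞 K => w (x : K)) (hu (e ⟨i, h⟩))
      simp only [Equiv.symm_apply_apply] at h6
      have h7 : ∀ x y : 𝓞 K, w ((x * y : 𝓞 K) : K) = w (x : K) * w (y : K) := by
        intro x y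
        have : ((x * y : 𝓞 K) : K) = (x : K) * (y : K) := map_mul (algebraMap (𝓞 K) K) x y
        rw [this, map_mul]
      rw [hplace, h7, hplace] at h6
      rw [h6, Real.log_mul _ (hpos _)]
      · ring
      · intro h0
        rw [h0, zero_mul] at h6
        exact hpos _ h6
  have hcf := class_formula K hp2
  rw [← hreg] at hcf
  have hQ := IsCMField.regulator_div_regulator_eq_two_pow_mul_indexRealUnits_inv K
  have hR := Units.regulator_pos K⁺
  have hRK := Units.regulator_pos K
  have hQ0 : (IsCMField.indexRealUnits K : ℝ) ≠ 0 := by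
    rcases IsCMField.indexRealUnits_eq_one_or_two K with h | h <;> simp [h]
  have hidx : ((Subgroup.closure (Set.range u) ⊔ Units.torsion K).index : ℝ) =
      IsCMField.indexRealUnits K * classNumber K⁺ := by
    rw [← Units.regOfFamily_div_regulator, div_eq_iff hRK.ne', ← hcf, ← hr]
    rw [div_eq_iff hR.ne'] at hQ
    rw [hQ]
    field_simp
  have hidx' : (Subgroup.closure (Set.range u) ⊔ Units.torsion K).index =
      IsCMField.indexRealUnits K * classNumber K⁺ := by exact_mod_cast hidx
  refine ⟨a w', fun i => a (e.symm i).1, u, hu, ?_, ?_, ?_⟩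
  · rw [← Units.regOfFamily_ne_zero_iff, ← hcf]
    have : (classNumber K⁺ : ℝ) ≠ 0 := by
      intro h
      have h' : classNumber K⁺ = 0 := by exact_mod_cast h
      exact hV (h' ▸ dvd_zero p)
    positivity
  · rw [hidx', hp.out.dvd_mul]
    rintro (h | h)
    · have := Nat.le_of_dvd (by rcases IsCMField.indexRealUnits_eq_one_or_two K with h | h <;> simp [h]) h
      rcases IsCMField.indexRealUnits_eq_one_or_two K with h | h <;> omega
    · exact hV h
  · intro b
    obtain ⟨w, hw⟩ := cover hp2 a hinj hcard b
    by_cases h : w = w'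
    · left; rwa [← h]
    · right
      exact ⟨e ⟨w, h⟩, by simpa using hw⟩
end
end

section
set_option linter.unusedSectionVars false
open NumberField

section
variable {p : ℕ} [hp : Fact p.Prime] (K : Type*) [Field K] [NumberField K]
  [IsCyclotomicExtension {p} ℚ K] [IsCMField K]

lemma indep_units (hp2 : p ≠ 2) {η : (𝓞 K)ˣ} (hη : IsPrimitiveRoot η p)
    {u : Fin (Units.rank K) → (𝓞 K)ˣ} (hu : Units.IsMaxRank u)
    (hi : ¬ p ∣ (Subgroup.closure (Set.range u) ⊔ Units.torsion K).index)
    (A : ℕ) (c : Fin (Units.rank K) → ℕ) (Y : (𝓞 K)ˣ) (h : η ^ A * ∏ i, u i ^ c i = Y ^ p) :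
    p ∣ A ∧ ∀ i, p ∣ c i := by
  set m := (Subgroup.closure (Set.range u) ⊔ Units.torsion K).index with hm
  have hη1 : IsOfFinOrder η := isOfFinOrder_iff_pow_eq_one.2 ⟨p, hp.out.pos, hη.pow_eq_one⟩
  have hlogη : Units.logEmbedding K (Additive.ofMul η) = 0 := by
    rw [Units.dirichletUnitTheorem.logEmbedding_eq_zero_iff, Units.torsion, CommGroup.mem_torsion]
    exact hη1
  have hY : Y ^ m ∈ Subgroup.closure (Set.range u) ⊔ Units.torsion K := Subgroup.pow_index_mem _ _
  rw [Subgroup.mem_sup] at hY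
  obtain ⟨v, hv, t, ht, hvt⟩ := hY
  obtain ⟨d, rfl⟩ := Subgroup.exists_finsupp_of_mem_closure_range _ _ hv
  have hcd : ∀ i, (m : ℤ) * c i = p * d i := by
    have h1 : (∏ i, u i ^ c i) ^ m = (Y ^ m) ^ p * (η ^ A)⁻¹ ^ m := by
      rw [← pow_mul, mul_comm m p, pow_mul, ← h, ← mul_pow]
      congr 1
      rw [mul_comm, inv_mul_cancel_left]
    rw [← hvt] at h1
    have h2 := congrArg (fun x => Units.logEmbedding K (Additive.ofMul x)) h1
    have hlogt : Units.logEmbedding K (Additive.ofMul t) = 0 := by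
      rwa [Units.dirichletUnitTheorem.logEmbedding_eq_zero_iff]
    rw [Finsupp.prod_fintype _ _ (by simp)] at h2
    simp only [ofMul_mul, ofMul_pow, ofMul_inv, map_add, map_nsmul, map_neg, hlogt, hlogη,
      ofMul_prod, map_sum, ofMul_zpow, map_zsmul, smul_zero, neg_zero, add_zero, Finset.smul_sum] at h2
    intro i
    have h3 : ∑ i, (((m : ℤ) * c i - p * d i : ℤ) : ℝ) • Units.logEmbedding K (Additive.ofMul (u i)) = 0 := by
      rw [← sub_eq_zero, ← Finset.sum_sub_distrib] at h2
      rw [← h2]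
      refine Finset.sum_congr rfl fun i _ => ?_
      rw [Int.cast_smul_eq_zsmul, sub_smul, mul_smul, mul_smul]
      simp only [natCast_zsmul]
    have h4 := Fintype.linearIndependent_iff.1 hu _ h3 i
    have h5 : ((m : ℤ) * c i - p * d i : ℤ) = 0 := by exact_mod_cast h4
    omega
  have hc : ∀ i, p ∣ c i := by
    intro i
    have h1 : (p : ℤ) ∣ m * c i := ⟨_, hcd i⟩
    have h2 : p ∣ m * c i := by exact_mod_cast h1
    exact (hp.out.dvd_mul.1 h2).resolve_left hi
  refine ⟨?_, hc⟩
  choose c' hc' using hc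
  set Z := Y * (∏ i, u i ^ c' i)⁻¹ with hZ
  have h6 : η ^ A = Z ^ p := by
    rw [hZ, mul_pow, ← h, inv_pow, ← Finset.prod_pow]
    simp only [← pow_mul, hc', mul_comm p, mul_inv_cancel_right]
  have hZt : Z ∈ Units.torsion K := by
    rw [Units.torsion, CommGroup.mem_torsion, isOfFinOrder_iff_pow_eq_one]
    refine ⟨p * p, Nat.mul_pos hp.out.pos hp.out.pos, ?_⟩
    rw [pow_mul, ← h6, ← pow_mul, mul_comm, pow_mul, hη.pow_eq_one, one_pow]
  have : NeZero p := ⟨hp.out.ne_zero⟩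
  have hord := IsCyclotomicExtension.Rat.torsionOrder_eq (n := p) (K := K)
  rw [if_neg (by rw [Nat.not_even_iff_odd]; exact hp.out.odd_of_ne_two hp2)] at hord
  rw [← Units.rootsOfUnity_eq_torsion, mem_rootsOfUnity, hord, mul_comm, pow_mul, ← h6, ← pow_mul] at hZt
  have h7 := (hp.out.dvd_mul.1 (hη.dvd_of_pow_eq_one _ hZt))
  refine h7.resolve_right fun h8 => hp2 ((Nat.prime_dvd_prime_iff_eq hp.out Nat.prime_two).1 h8)

lemma unit_of_pow {y : K} {v : (𝓞 K)ˣ} (h : y ^ p = algebraMap (𝓞 K) K v) :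
    ∃ Y : (𝓞 K)ˣ, Y ^ p = v := by
  have hi : IsIntegral ℤ y := by
    apply IsIntegral.of_pow hp.out.pos
    rw [h]
    exact RingOfIntegers.isIntegral_coe _
  obtain ⟨x, rfl⟩ : ∃ x : 𝓞 K, algebraMap (𝓞 K) K x = y := ⟨⟨y, hi⟩, rfl⟩
  have h2 : x ^ p = v := by
    apply RingOfIntegers.coe_injective
    rw [map_pow, ← h]
  have h3 : IsUnit x := by
    rw [← isUnit_pow_iff hp.out.ne_zero, h2]; exact v.isUnit
  exact ⟨h3.unit, Units.ext h2⟩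

lemma indep_main (hp2 : p ≠ 2) {η : 𝓞 K} (hη : IsPrimitiveRoot η p)
    {u : Fin (Units.rank K) → (𝓞 K)ˣ} (hu : Units.IsMaxRank u)
    (hi : ¬ p ∣ (Subgroup.closure (Set.range u) ⊔ Units.torsion K).index) (k0 : (ZMod p)ˣ)
    (A B : ℕ) (c : Fin (Units.rank K) → ℕ) (α : K)
    (h : algebraMap (𝓞 K) K η ^ A * (1 - algebraMap (𝓞 K) K η ^ (k0 : ZMod p).val) ^ B * ∏ i, algebraMap (𝓞 K) K (u i) ^ c i = α ^ p) :
    p ∣ A ∧ p ∣ B ∧ ∀ i, p ∣ c i := by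
  have hη' : IsPrimitiveRoot (η ^ (k0 : ZMod p).val) p :=
    hη.pow_of_coprime _ (ZMod.val_coe_unit_coprime k0)
  have hN := absNorm_prim K hη'
  set π : 𝓞 K := 1 - η ^ (k0 : ZMod p).val with hπ
  have hN2 : Ideal.absNorm (Ideal.span {π}) = p := by
    rw [← hN, ← Ideal.span_singleton_neg]; congr 3; rw [hπ]; ring
  have hπ0 : π ≠ 0 := by
    intro h0
    rw [h0] at hN2
    simp at hN2
    exact hp.out.ne_zero hN2.symm
  obtain ⟨E, hE⟩ : ∃ E : (𝓞 K)ˣ, (E : 𝓞 K) = η := ⟨(hη.isUnit hp.out.ne_zero).unit, rfl⟩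
  have hEp : IsPrimitiveRoot E p := by
    rw [← IsPrimitiveRoot.coe_units_iff, hE]; exact hη
  have hmain : α ^ p = algebraMap (𝓞 K) K ((E ^ A * ∏ i, u i ^ c i : (𝓞 K)ˣ) : 𝓞 K) * algebraMap (𝓞 K) K π ^ B := by
    rw [← h, hπ, ← hE]
    rw [Units.val_mul, Units.coe_prod, map_mul (algebraMap (𝓞 K) K), map_prod, map_sub, map_one]
    simp only [Units.val_pow_eq_pow_val, map_pow]
    ring
  have hIntg : IsIntegral ℤ α := by
    apply IsIntegral.of_pow hp.out.pos
    rw [hmain]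
    exact (RingOfIntegers.isIntegral_coe _).mul ((RingOfIntegers.isIntegral_coe _).pow _)
  have hB : p ∣ B := by
    obtain ⟨x, hx⟩ : ∃ x : 𝓞 K, algebraMap (𝓞 K) K x = α := ⟨⟨α, hIntg⟩, rfl⟩
    have h1 : x ^ p = ((E ^ A * ∏ i, u i ^ c i : (𝓞 K)ˣ) : 𝓞 K) * π ^ B := by
      apply RingOfIntegers.coe_injective
      rw [map_mul, map_pow, map_pow, ← hmain, hx]
    have h2 := congrArg (fun x => Ideal.absNorm (Ideal.span {x})) h1
    simp only [← Ideal.span_singleton_mul_span_singleton, ← Ideal.span_singleton_pow, map_mul,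
      map_pow, hN2, Ideal.span_singleton_eq_top.2 (Units.isUnit _), Ideal.absNorm_top, one_mul] at h2
    have h3 := congrArg (fun n => n.factorization p) h2
    simp [hp.out.factorization_self] at h3
    exact ⟨_, h3.symm⟩
  obtain ⟨B', rfl⟩ := hB
  have hπ0' : algebraMap (𝓞 K) K π ≠ (0 : K) := by
    intro h0; exact hπ0 (RingOfIntegers.coe_injective (by simpa using h0))
  have h4 : (α / algebraMap (𝓞 K) K π ^ B') ^ p = algebraMap (𝓞 K) K ((E ^ A * ∏ i, u i ^ c i : (𝓞 K)ˣ) : 𝓞 K) := by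
    rw [div_pow, hmain, ← pow_mul, mul_comm B' p, mul_div_assoc, div_self (pow_ne_zero _ hπ0'), mul_one]
  obtain ⟨Y, hY⟩ := unit_of_pow K h4
  obtain ⟨h5, h6⟩ := indep_units K hp2 hEp hu hi A c Y hY.symm
  exact ⟨h5, dvd_mul_right _ _, h6⟩
end
end

section
set_option linter.unusedSectionVars false

section
variable {p : ℕ} [hp : Fact p.Prime] {F E ι : Type*} [Field F] [Field E] [Algebra F E]
  [Fintype ι] [DecidableEq ι]

lemma zpow_val_add {ζ : F} (hζ : IsPrimitiveRoot ζ p) (a b : ZMod p) :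
    ζ ^ (a + b).val = ζ ^ a.val * ζ ^ b.val := by
  rw [ZMod.val_add, ← pow_add]
  conv_rhs => rw [← Nat.mod_add_div (a.val + b.val) p, pow_add, pow_mul, hζ.pow_eq_one, one_pow, mul_one]

lemma zpow_val_cast {ζ : F} (hζ : IsPrimitiveRoot ζ p) (a : ℕ) :
    ζ ^ (a : ZMod p).val = ζ ^ a := by
  rw [ZMod.val_natCast]
  conv_rhs => rw [← Nat.mod_add_div a p, pow_add, pow_mul, hζ.pow_eq_one, one_pow, mul_one]

lemma zpow_val_inj {ζ : F} (hζ : IsPrimitiveRoot ζ p) {a b : ZMod p} (h : ζ ^ a.val = ζ ^ b.val) : a = b :=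
  ZMod.val_injective p (hζ.pow_inj (ZMod.val_lt a) (ZMod.val_lt b) h)

lemma kummer_main [FiniteDimensional F E] [IsGalois F E] {ζ : F} (hζ : IsPrimitiveRoot ζ p)
    (a : ι → F) (ha : ∀ i, a i ≠ 0) (α : ι → E) (hα : ∀ i, α i ^ p = algebraMap F E (a i))
    (htop : IntermediateField.adjoin F (Set.range α) = ⊤)
    (hind : ∀ (c : ι → ℕ) (β : F), ∏ i, a i ^ c i = β ^ p → ∀ i, p ∣ c i) :
    Nonempty ((E ≃ₐ[F] E) ≃* Multiplicative (ι → ZMod p)) := by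
  have hα0 : ∀ i, α i ≠ 0 := by
    intro i h
    have := hα i
    rw [h, zero_pow hp.out.ne_zero] at this
    exact ha i ((map_eq_zero _).1 this.symm)
  have hζE : IsPrimitiveRoot (algebraMap F E ζ) p := hζ.map_of_injective (algebraMap F E).injective
  have hex : ∀ (σ : E ≃ₐ[F] E) (i : ι), ∃ k : ZMod p, σ (α i) = (algebraMap F E ζ) ^ k.val * α i := by
    intro σ i
    have h1 : (σ (α i) / α i) ^ p = 1 := by
      rw [div_pow, ← map_pow, hα, AlgEquiv.commutes, div_self]
      rw [← hα]; exact pow_ne_zero _ (hα0 i)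
    obtain ⟨k, hk, hk2⟩ := hζE.eq_pow_of_pow_eq_one h1
    refine ⟨k, ?_⟩
    rw [zpow_val_cast hζE, hk2, div_mul_cancel₀ _ (hα0 i)]
  choose k hk using hex
  let φ : (E ≃ₐ[F] E) →* Multiplicative (ι → ZMod p) := MonoidHom.mk' (fun σ => Multiplicative.ofAdd (k σ)) (by
    intro σ τ
    rw [← ofAdd_add]
    congr 1
    funext i
    apply zpow_val_inj hζE
    apply mul_right_cancel₀ (hα0 i)
    rw [← hk, Pi.add_apply, zpow_val_add hζE, AlgEquiv.mul_apply, hk τ, map_mul, map_pow,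
      AlgEquiv.commutes, hk σ]
    ring)
  have hφ : ∀ σ, Multiplicative.toAdd (φ σ) = k σ := fun σ => rfl
  have hinj : Function.Injective φ := by
    intro σ τ h
    have h1 : k σ = k τ := h
    have h2 : ∀ x ∈ IntermediateField.adjoin F (Set.range α), σ x = τ x := by
      intro x hx
      induction hx using IntermediateField.adjoin_induction with
      | mem x hx => obtain ⟨i, rfl⟩ := hx; rw [hk, hk, h1]
      | algebraMap x => simp
      | add x y _ _ h1 h2 => rw [map_add, map_add, h1, h2]
      | inv x _ h1 => rw [map_inv₀, map_inv₀, h1]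
      | mul x y _ _ h1 h2 => rw [map_mul, map_mul, h1, h2]
    ext x
    exact h2 x (by rw [htop]; trivial)
  have hsurj : Function.Surjective φ := by
    let S : AddSubgroup (ι → ZMod p) := (MonoidHom.toAdditiveLeft φ).range
    let W : Submodule (ZMod p) (ι → ZMod p) := AddSubgroup.toZModSubmodule p S
    have hW : W = ⊤ := by
      by_contra hne
      obtain ⟨f, hf0, hf⟩ := Submodule.exists_le_ker_of_lt_top W (lt_top_iff_ne_top.2 hne)
      apply hf0
      set c : ι → ZMod p := fun i => f (Pi.single i 1) with hc
      have hfv : ∀ v, f v = ∑ i, v i * c i := by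
        intro v
        rw [LinearMap.pi_apply_eq_sum_univ f v];
        refine Finset.sum_congr rfl fun i _ => ?_
        rw [smul_eq_mul, hc]
        congr 2
        funext j
        simp [Pi.single_apply, eq_comm]
      set β : E := ∏ i, α i ^ (c i).val with hβ
      have hfix : ∀ σ : E ≃ₐ[F] E, σ β = β := by
        intro σ
        have h0 : ∑ i, k σ i * c i = 0 := by
          rw [← hfv]
          exact hf (show k σ ∈ W from ⟨Additive.ofMul σ, rfl⟩)
        have h1 : ∏ i, (algebraMap F E ζ) ^ ((k σ i).val * (c i).val) = 1 := by
          rw [Finset.prod_pow_eq_pow_sum, ← zpow_val_cast hζE]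
          push_cast
          simp only [ZMod.natCast_zmod_val, h0, ZMod.val_zero, pow_zero]
        rw [hβ, map_prod]
        simp only [map_pow, hk, mul_pow, ← pow_mul]
        rw [Finset.prod_mul_distrib, h1, one_mul]
      have hmem := (IsGalois.mem_bot_iff_fixed (F := F) (E := E) β).2 hfix
      rw [IntermediateField.mem_bot] at hmem
      obtain ⟨b, hb⟩ := hmem
      have h2 : ∏ i, a i ^ (c i).val = b ^ p := by
        apply (algebraMap F E).injective
        rw [map_pow, hb, hβ, map_prod, ← Finset.prod_pow]
        refine Finset.prod_congr rfl fun i _ => ?_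
        rw [map_pow, ← hα, ← pow_mul, ← pow_mul, mul_comm]
      have h3 := hind _ _ h2
      have h4 : ∀ i, c i = 0 := by
        intro i
        rw [← ZMod.natCast_zmod_val (c i)]
        exact (ZMod.natCast_eq_zero_iff _ _).2 (h3 i)
      ext v
      simp [h4, hfv]
    intro y
    have : Multiplicative.toAdd y ∈ W := by rw [hW]; trivial
    obtain ⟨σ, hσ⟩ := this
    exact ⟨Additive.toMul σ, hσ⟩
  exact ⟨MulEquiv.ofBijective φ ⟨hinj, hsurj⟩⟩
end
end

section
set_option linter.unusedSectionVars false
open NumberField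

section
variable {p : ℕ} [hp : Fact p.Prime] (K : Type*) [Field K] [NumberField K]
  [IsCyclotomicExtension {p} ℚ K] [IsCMField K]

lemma mem_of_pow_eq {Ω : Type*} [Field Ω] [Algebra K Ω] {z : K} (hz : IsPrimitiveRoot z p)
    (M : IntermediateField K Ω) {y w : Ω} (hy : y ∈ M) (h : w ^ p = y ^ p) : w ∈ M := by
  by_cases hy0 : y = 0
  · rw [hy0, zero_pow hp.out.ne_zero] at h
    rw [eq_zero_of_pow_eq_zero h]; exact M.zero_mem
  have hZ : IsPrimitiveRoot (algebraMap K Ω z) p := hz.map_of_injective (algebraMap K Ω).injective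
  have h1 : (w / y) ^ p = 1 := by rw [div_pow, h, div_self (pow_ne_zero _ hy0)]
  obtain ⟨k, hk, hk2⟩ := hZ.eq_pow_of_pow_eq_one h1
  rw [← div_mul_cancel₀ w hy0, ← hk2, ← map_pow]
  exact M.mul_mem (M.algebraMap_mem _) hy

lemma gal_main (hp2 : p ≠ 2) (hV : ¬ p ∣ classNumber (maximalRealSubfield K))
    {Ω : Type*} [Field Ω] [Algebra K Ω] [IsAlgClosed Ω] [Algebra.IsAlgebraic K Ω]
    (L : IntermediateField K Ω)
    (hL : L = IntermediateField.adjoin K {x : Ω | 1 - (1 - x ^ p) ^ p = 0}) :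
    Nonempty ((L ≃ₐ[K] L) ≃* Multiplicative (Fin ((p + 1) / 2) → ZMod p)) ∧
      Module.finrank K L = p ^ ((p + 1) / 2) := by
  have hodd : Odd p := hp.out.odd_of_ne_two hp2
  obtain ⟨η, hη⟩ := prim_exists (p := p) K
  obtain ⟨k0, k, u, hku, hu, hidx, hcov⟩ := index_main K hp2 hV hη
  set z : K := algebraMap (𝓞 K) K η with hzdef
  have hz : IsPrimitiveRoot z p := hη.map_of_injective RingOfIntegers.coe_injective
  set Z : Ω := algebraMap K Ω z with hZdef
  have hZ : IsPrimitiveRoot Z p := hz.map_of_injective (algebraMap K Ω).injective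
  have hZ0 : Z ≠ 0 := hZ.ne_zero hp.out.ne_zero
  have hku' : ∀ i, 1 - z ^ (k i : ZMod p).val = algebraMap (𝓞 K) K (u i) * (1 - z ^ (k0 : ZMod p).val) := by
    intro i
    have := congrArg (algebraMap (𝓞 K) K) (hku i)
    rw [map_mul, map_sub, map_sub, map_one, map_pow, map_pow] at this
    exact this
  have hne : ∀ b : (ZMod p)ˣ, 1 - z ^ (b : ZMod p).val ≠ 0 := by
    intro b h
    have h1 := (hz.pow_of_coprime _ (ZMod.val_coe_unit_coprime b)).ne_one hp.out.one_lt
    exact h1 (sub_eq_zero.1 h).symm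
  set a : Option (Option (Fin (Units.rank K))) → K := fun o => match o with
    | none => z
    | some none => 1 - z ^ (k0 : ZMod p).val
    | some (some i) => algebraMap (𝓞 K) K (u i) with ha
  have ha0 : ∀ o, a o ≠ 0 := by
    rintro (_ | _ | i)
    · exact hz.ne_zero hp.out.ne_zero
    · exact hne k0
    · intro h
      have := hku' i
      rw [show algebraMap (𝓞 K) K (u i) = 0 from h, zero_mul] at this
      exact hne _ this
  have hex : ∀ o, ∃ x : Ω, x ^ p = algebraMap K Ω (a o) := fun o =>
    IsAlgClosed.exists_pow_nat_eq _ hp.out.pos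
  choose α hα using hex
  have hα1 : α none ^ p = Z := hα none
  have hα2 : α (some none) ^ p = 1 - Z ^ (k0 : ZMod p).val := by
    rw [hα]; simp [ha, hZdef]
  have hα3 : ∀ i, (α (some (some i)) * α (some none)) ^ p = 1 - Z ^ (k i : ZMod p).val := by
    intro i
    rw [mul_pow, hα2, hα]
    have := congrArg (algebraMap K Ω) (hku' i)
    simp only [map_mul, map_sub, map_one, map_pow] at this
    rw [this]
  have hα20 : α (some none) ≠ 0 := by
    intro h
    have h1 := hα (some none)
    rw [h, zero_pow hp.out.ne_zero] at h1
    exact ha0 (some none) ((map_eq_zero (algebraMap K Ω)).1 h1.symm)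
  have hS : ∀ (x : Ω) (j : ℕ), x ^ p = 1 - Z ^ j → x ∈ L := by
    intro x j hx
    rw [hL]
    apply IntermediateField.subset_adjoin
    change 1 - (1 - x ^ p) ^ p = 0
    rw [hx, sub_sub_cancel, ← pow_mul, mul_comm, pow_mul, hZ.pow_eq_one, one_pow, sub_self]
  have hαL : ∀ o, α o ∈ L := by
    have h2 : α (some none) ∈ L := hS _ _ hα2
    rintro (_ | _ | i)
    · obtain ⟨x, hx⟩ := IsAlgClosed.exists_pow_nat_eq (1 - Z ^ 1) hp.out.pos
      obtain ⟨y, hy⟩ := IsAlgClosed.exists_pow_nat_eq (1 - Z ^ (p - 1)) hp.out.pos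
      have h3 : Z * Z ^ (p - 1) = 1 := by
        rw [← pow_succ', Nat.sub_add_cancel hp.out.one_lt.le, hZ.pow_eq_one]
      have h1Z : 1 - Z ^ (p - 1) ≠ 0 := by
        intro h
        rw [← sub_eq_zero.1 h, mul_one] at h3
        exact hZ.ne_one hp.out.one_lt h3
      refine mem_of_pow_eq K hz L (y := -(x / y)) (L.neg_mem (L.div_mem (hS _ _ hx) (hS _ _ hy))) ?_
      rw [hα1, hodd.neg_pow, div_pow, hx, hy, pow_one, ← neg_div, eq_div_iff h1Z, mul_sub, h3]
      ring
    · exact h2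
    · obtain ⟨x, hx⟩ := IsAlgClosed.exists_pow_nat_eq (1 - Z ^ (k i : ZMod p).val) hp.out.pos
      refine mem_of_pow_eq K hz L (y := x / α (some none)) (L.div_mem (hS _ _ hx) h2) ?_
      rw [div_pow, hx, ← hα3, mul_pow, mul_div_assoc, div_self (pow_ne_zero _ hα20), mul_one]
  have hLα : L = IntermediateField.adjoin K (Set.range α) := by
    apply le_antisymm
    · rw [hL, IntermediateField.adjoin_le_iff]
      intro x hx
      change 1 - (1 - x ^ p) ^ p = 0 at hx
      set M := IntermediateField.adjoin K (Set.range α) with hM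
      have hmem : ∀ o, α o ∈ M := fun o => IntermediateField.subset_adjoin _ _ ⟨o, rfl⟩
      obtain ⟨j, hj, hj2⟩ := hZ.eq_pow_of_pow_eq_one (sub_eq_zero.1 hx).symm
      have hxj : x ^ p = 1 - Z ^ j := by rw [hj2]; ring
      by_cases hj0 : j = 0
      · rw [hj0, pow_zero, sub_self] at hxj
        rw [eq_zero_of_pow_eq_zero hxj]; exact M.zero_mem
      have hb0 : (j : ZMod p) ≠ 0 := by
        intro h
        exact hj0 (Nat.eq_zero_of_dvd_of_lt ((ZMod.natCast_eq_zero_iff _ _).1 h) hj)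
      set b : (ZMod p)ˣ := Units.mk0 _ hb0 with hb
      have hbv : Z ^ (b : ZMod p).val = Z ^ j := by rw [hb, Units.val_mk0, zpow_val_cast hZ]
      have hneg : ∀ (b' : (ZMod p)ˣ) (w : Ω), b' = -b → w ∈ M → w ^ p = 1 - Z ^ (b' : ZMod p).val → x ∈ M := by
        intro b' w hb' hw hw2
        have h5 : Z ^ j * Z ^ (b' : ZMod p).val = 1 := by
          rw [← hbv, ← zpow_val_add hZ, hb']; simp
        refine mem_of_pow_eq K hz M (y := -(α none ^ j * w)) (M.neg_mem (M.mul_mem (pow_mem (hmem none) j) hw)) ?_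
        rw [hodd.neg_pow, mul_pow, hw2, ← pow_mul, mul_comm j p, pow_mul, hα1, mul_sub, h5, hxj]
        ring
      rcases hcov b with (h | h) | ⟨i, h | h⟩
      · refine mem_of_pow_eq K hz M (hmem (some none)) ?_
        rw [hα2, h, hbv, hxj]
      · exact hneg _ _ h (hmem (some none)) hα2
      · refine mem_of_pow_eq K hz M (M.mul_mem (hmem (some (some i))) (hmem (some none))) ?_
        rw [hα3, h, hbv, hxj]
      · exact hneg _ _ h (M.mul_mem (hmem (some (some i))) (hmem (some none))) (hα3 i)
    · rw [IntermediateField.adjoin_le_iff]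
      rintro _ ⟨o, rfl⟩
      exact hαL o
  have hfin : FiniteDimensional K L := by
    rw [hLα]
    exact IntermediateField.finiteDimensional_adjoin (fun x _ => Algebra.IsIntegral.isIntegral x)
  have : IsAlgClosure K Ω := ⟨inferInstance, inferInstance⟩
  have : Normal K Ω := IsAlgClosure.normal K Ω
  have hnorm : Normal K L := by
    rw [IntermediateField.normal_iff_forall_map_le]
    intro σ
    rw [hL, IntermediateField.adjoin_map]
    apply IntermediateField.adjoin.mono
    rintro _ ⟨x, hx, rfl⟩
    change 1 - (1 - x ^ p) ^ p = 0 at hx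
    change 1 - (1 - (σ x) ^ p) ^ p = 0
    have := congrArg σ hx
    simpa using this
  have hgal : IsGalois K L := ⟨⟩
  have hcard : Fintype.card (Option (Option (Fin (Units.rank K)))) = (p + 1) / 2 := by
    have h1 := card_places (p := p) K
    have h2 : Units.rank K = Fintype.card (InfinitePlace K) - 1 := rfl
    rw [Fintype.card_option, Fintype.card_option, Fintype.card_fin, h2, h1]
    obtain ⟨m, hm⟩ := hodd
    have := hp.out.two_le
    omega
  obtain ⟨e⟩ := kummer_main (F := K) (E := L) hz a ha0 (fun o => (⟨α o, hαL o⟩ : L))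
    (fun o => Subtype.ext (by simpa using hα o))
    (by
      apply IntermediateField.lift_injective L
      rw [IntermediateField.lift_adjoin, IntermediateField.lift_top, ← Set.range_comp]
      exact hLα.symm)
    (by
      intro c β h
      rw [Fintype.prod_option, Fintype.prod_option, ← mul_assoc] at h
      obtain ⟨h1, h2, h3⟩ := indep_main K hp2 hη hu hidx k0 _ _ _ _ h
      rintro (_ | _ | i)
      exacts [h1, h2, h3 i])
  have e' : (L ≃ₐ[K] L) ≃* Multiplicative (Fin ((p + 1) / 2) → ZMod p) :=
    e.trans (AddEquiv.toMultiplicative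
      (LinearEquiv.funCongrLeft (ZMod p) (ZMod p) (Fintype.equivFinOfCardEq hcard).symm).toAddEquiv)
  refine ⟨⟨e'⟩, ?_⟩
  rw [← IsGalois.card_aut_eq_finrank, Nat.card_congr e'.toEquiv, Nat.card_congr Multiplicative.toAdd]
  simp
end
end

set_option linter.unusedSectionVars false
open NumberField

section
variable {p : ℕ} [hp : Fact p.Prime] (K : Type*) [Field K] [NumberField K]
  [IsCyclotomicExtension {p} ℚ K] [IsCMField K]

lemma real_eq (hp2 : p ≠ 2) {z : K} (hz : IsPrimitiveRoot z p) (x : K) :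
    x ∈ IntermediateField.adjoin ℚ {z + z⁻¹} ↔ x ∈ maximalRealSubfield K := by
  have hz0 : z ≠ 0 := hz.ne_zero hp.out.ne_zero
  set T := IntermediateField.adjoin ℚ {z + z⁻¹} with hT
  have hs : z + z⁻¹ ∈ T := IntermediateField.subset_adjoin _ _ rfl
  have hconj : IsCMField.complexConj K z = z⁻¹ := by
    obtain ⟨φ⟩ : Nonempty (K →+* ℂ) := inferInstance
    apply φ.injective
    rw [IsCMField.complexEmbedding_complexConj, map_inv₀]
    have h1 : ‖φ z‖ = 1 :=
      (hz.map_of_injective φ.injective).norm'_eq_one hp.out.ne_zero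
    rw [Complex.inv_eq_conj h1]
  have hTR : ∀ x ∈ T, IsCMField.complexConj K x = x := by
    intro x hx
    induction hx using IntermediateField.adjoin_induction with
    | mem x hx =>
      rw [Set.mem_singleton_iff.1 hx, map_add, map_inv₀, hconj, inv_inv, add_comm]
    | algebraMap x => rw [eq_ratCast, map_ratCast]
    | add x y _ _ h1 h2 => rw [map_add, h1, h2]
    | inv x _ h1 => rw [map_inv₀, h1]
    | mul x y _ _ h1 h2 => rw [map_mul, h1, h2]
  rw [← IsCMField.complexConj_eq_self_iff]
  refine ⟨hTR x, fun hx => ?_⟩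
  have hrep : ∃ a ∈ T, ∃ b ∈ T, x = a + b * z := by
    have htop := IsCyclotomicExtension.adjoin_primitive_root_eq_top (A := ℚ) (n := p) hz
    have hmem : x ∈ Algebra.adjoin ℚ {z} := by rw [htop]; trivial
    clear hx
    induction hmem using Algebra.adjoin_induction with
    | mem x hx => exact ⟨0, T.zero_mem, 1, T.one_mem, by rw [Set.mem_singleton_iff.1 hx]; ring⟩
    | algebraMap r => exact ⟨_, T.algebraMap_mem r, 0, T.zero_mem, by ring⟩
    | add x y _ _ h1 h2 =>
      obtain ⟨a, ha, b, hb, rfl⟩ := h1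
      obtain ⟨c, hc, d, hd, rfl⟩ := h2
      exact ⟨_, T.add_mem ha hc, _, T.add_mem hb hd, by ring⟩
    | mul x y _ _ h1 h2 =>
      obtain ⟨a, ha, b, hb, rfl⟩ := h1
      obtain ⟨c, hc, d, hd, rfl⟩ := h2
      refine ⟨_, T.sub_mem (T.mul_mem ha hc) (T.mul_mem hb hd), _,
        T.add_mem (T.add_mem (T.mul_mem ha hd) (T.mul_mem hb hc)) (T.mul_mem (T.mul_mem hb hd) hs), ?_⟩
      have : z⁻¹ * z = 1 := inv_mul_cancel₀ hz0
      linear_combination (-b * d) * this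
  obtain ⟨a, ha, b, hb, rfl⟩ := hrep
  rw [map_add, map_mul, hTR a ha, hTR b hb, hconj] at hx
  have h1 : b * (z⁻¹ - z) = 0 := by linear_combination hx
  rcases mul_eq_zero.1 h1 with h | h
  · rw [h, zero_mul, add_zero]; exact ha
  · exfalso
    have h2 : z ^ 2 = 1 := by
      rw [sq]; nth_rw 1 [← sub_eq_zero.1 h]; exact inv_mul_cancel₀ hz0
    exact hp2 ((Nat.prime_dvd_prime_iff_eq hp.out Nat.prime_two).1 (hz.dvd_of_pow_eq_one _ h2))
end

theorem stmt_5 (p : ℕ) (hp : p.Prime) (hodd : Odd p)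
    (ζ : AlgebraicClosure ℚ) (hζ : IsPrimitiveRoot ζ p)
    (hV : ¬ p ∣ Nat.card (ClassGroup (NumberField.RingOfIntegers
      (IntermediateField.adjoin ℚ {ζ + ζ⁻¹}))))
    (K : IntermediateField ℚ (AlgebraicClosure ℚ))
    (hK : K = IntermediateField.adjoin ℚ {ζ})
    (L : IntermediateField K (AlgebraicClosure ℚ))
    (hL : L = IntermediateField.adjoin K
      {x : AlgebraicClosure ℚ | 1 - (1 - x ^ p) ^ p = 0}) :
    Nonempty ((L ≃ₐ[K] L) ≃* Multiplicative (Fin ((p + 1) / 2) → ZMod p)) ∧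
      Module.finrank K L = p ^ ((p + 1) / 2) := by
  have hp2 : p ≠ 2 := by rintro rfl; revert hodd; decide
  have : Fact p.Prime := ⟨hp⟩
  have : NeZero p := ⟨hp.ne_zero⟩
  have halg : Algebra.IsAlgebraic ℚ (AlgebraicClosure ℚ) := by
    have hgen : ∀ i1 : Algebra ℚ (AlgebraicClosure ℚ),
        @Algebra.IsAlgebraic ℚ (AlgebraicClosure ℚ) _ _ i1 := by
      intro i1
      obtain rfl : i1 = AlgebraicClosure.instAlgebra ℚ := Subsingleton.elim _ _
      exact AlgebraicClosure.isAlgebraic ℚ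
    exact hgen _
  have hcyc : IsCyclotomicExtension {p} ℚ K := by
    rw [hK]; exact hζ.intermediateField_adjoin_isCyclotomicExtension ℚ
  have : NumberField K := IsCyclotomicExtension.numberField {p} ℚ K
  have : IsCMField K := IsCyclotomicExtension.Rat.isCMField K
    (S := {p}) ⟨p, rfl, lt_of_le_of_ne hp.two_le hp2.symm⟩
  have : Algebra.IsAlgebraic K (AlgebraicClosure ℚ) := Algebra.IsAlgebraic.tower_top (K := ℚ) K
  refine gal_main K hp2 ?_ L hL
  have hζK : ζ ∈ K := by rw [hK]; exact IntermediateField.subset_adjoin _ _ rfl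
  obtain ⟨z, hz⟩ : ∃ z : K, (z : AlgebraicClosure ℚ) = ζ := ⟨⟨ζ, hζK⟩, rfl⟩
  have hzp : IsPrimitiveRoot z p := by
    refine IsPrimitiveRoot.of_map_of_injective (f := K.val) ?_ K.val.injective
    change IsPrimitiveRoot (z : AlgebraicClosure ℚ) p
    rw [hz]; exact hζ
  let T : @IntermediateField ℚ K _ _ K.algebra' := @IntermediateField.adjoin ℚ _ K _ K.algebra' {z + z⁻¹}
  have hTdef : T = @IntermediateField.adjoin ℚ _ K _ K.algebra' {z + z⁻¹} := rfl
  have key : ∀ (i1 : Algebra ℚ K) (x : K), x ∈ @IntermediateField.adjoin ℚ _ K _ i1 {z + z⁻¹} ↔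
      x ∈ maximalRealSubfield K := by
    intro i1
    obtain rfl : i1 = DivisionRing.toRatAlgebra := Subsingleton.elim _ _
    exact real_eq K hp2 hzp
  have hmap : T.map K.val = IntermediateField.adjoin ℚ {ζ + ζ⁻¹} := by
    rw [hTdef, IntermediateField.adjoin_map, Set.image_singleton]
    congr 2
    rw [map_add, map_inv₀]
    change (z : AlgebraicClosure ℚ) + (z : AlgebraicClosure ℚ)⁻¹ = _
    rw [hz]
  have e1 : (IntermediateField.adjoin ℚ {ζ + ζ⁻¹} : IntermediateField ℚ (AlgebraicClosure ℚ)) ≃+*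
      T :=
    ((IntermediateField.equivOfEq hmap).symm.trans
      (IntermediateField.equivMap _ K.val).symm).toRingEquiv
  have hsub : T.toSubfield = maximalRealSubfield K := by
    ext x
    exact key _ x
  have e2 : T ≃+* maximalRealSubfield K :=
    RingEquiv.subfieldCongr hsub
  have e3 := (ClassGroup.mulEquiv (RingOfIntegers.mapRingEquiv (e1.trans e2))).toEquiv
  rw [Nat.card_congr e3] at hV
  rwa [classNumber, ← Nat.card_eq_fintype_card]
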